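/- arXiv:1902.08637 — 3 statements merged into one kernel-verified Lean document; each statement's English description precedes it below -/
import Mathlib

section
/- Let ψ ∈ T_n and let A = (A₁,…,Aₙ) be pairwise commuting generators of uniformly bounded C₀-semigroups on a complex Banach space X. Assume either that σ_a(Aⱼ) ⊆ {z ∈ ℂ : Re z < 0} for all j, or that ∂ψ(−0)/∂sⱼ ≠ ∞ (the limit of ∂ψ/∂sⱼ at the origin is finite) for all j. Then ψ maps the joint approximate point spectrum of A into the approximate point spectrum of ψ(A): σ_a(ψ(A)) ⊇ ψ(σ_a(A)). -/
open MeasureTheory Filter Topology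

noncomputable section

/-- A (one-parameter) `C₀`-semigroup of bounded operators on `X`. -/
def IsC0Semigroup {X : Type*} [NormedAddCommGroup X] [NormedSpace ℂ X]
    (T : ℝ → X →L[ℂ] X) : Prop :=
  T 0 = 1 ∧ (∀ s t : ℝ, 0 ≤ s → 0 ≤ t → T (s + t) = T s ∘L T t) ∧
    ∀ x : X, Tendsto (fun t => T t x) (𝓝[≥] (0 : ℝ)) (𝓝 x)

/-- `InGenDomain T x y` means `x` belongs to the domain of the infinitesimal generator `A`
of the semigroup `T` and `A x = y`. -/
def InGenDomain {X : Type*} [NormedAddCommGroup X] [NormedSpace ℂ X]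
    (T : ℝ → X →L[ℂ] X) (x y : X) : Prop :=
  Tendsto (fun t : ℝ => t⁻¹ • (T t x - x)) (𝓝[>] (0 : ℝ)) (𝓝 y)

/-- The `n`-parameter semigroup `T(u) = T₁(u₁) ⋯ Tₙ(uₙ)`. -/
def Tprod {X : Type*} [NormedAddCommGroup X] [NormedSpace ℂ X] {n : ℕ}
    (T : Fin n → ℝ → X →L[ℂ] X) (u : Fin n → ℝ) : X →L[ℂ] X :=
  (List.ofFn fun j => T j (u j)).prod

/-- The open negative orthant `(-∞,0)ⁿ`. -/
def negOrthant (n : ℕ) : Set (Fin n → ℝ) := {s | ∀ j, s j < 0}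

/-- The closed nonpositive orthant `(-∞,0]ⁿ`. -/
def nonposOrthant (n : ℕ) : Set (Fin n → ℝ) := {s | ∀ j, s j ≤ 0}

/-- A function of `n` variables is absolutely monotone on `(-∞,0)ⁿ` if it is nonnegative
together with all its iterated partial derivatives there. -/
def AbsMonotoneOn (n : ℕ) (f : (Fin n → ℝ) → ℝ) : Prop :=
  ∀ (k : ℕ) (v : Fin k → Fin n) (s : Fin n → ℝ), s ∈ negOrthant n →
    0 ≤ iteratedFDerivWithin ℝ k f (negOrthant n) s (fun i => Pi.single (v i) 1)

/-- Membership in the class `𝒯ₙ` of (negative) Bernstein functions of `n` variables: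
`ψ` is a nonpositive `C^∞`-function on `(-∞,0)ⁿ` all of whose first-order partial
derivatives are absolutely monotone. -/
def MemTn (n : ℕ) (ψ : (Fin n → ℝ) → ℝ) : Prop :=
  ContDiffOn ℝ (⊤ : ℕ∞) ψ (negOrthant n) ∧ (∀ s ∈ negOrthant n, ψ s ≤ 0) ∧
    ∀ j : Fin n, AbsMonotoneOn n
      (fun s => fderivWithin ℝ ψ (negOrthant n) s (Pi.single j 1))

/-- The Lévy–Khintchine type representation
`ψ(s) = c₀ + c₁·s + ∫ (e^{s·u} - 1) dμ(u)` of a Bernstein function of `n` variables,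
where `c₀ ≤ 0`, `c₁ ∈ ℝ₊ⁿ` and `μ` is a positive measure on `ℝ₊ⁿ \ {0}`. -/
def HasLevyRep (n : ℕ) (ψ : (Fin n → ℝ) → ℝ) (c₀ : ℝ) (c₁ : Fin n → ℝ)
    (μ : Measure (Fin n → ℝ)) : Prop :=
  c₀ ≤ 0 ∧ (∀ j, 0 ≤ c₁ j) ∧ μ {u | ¬ ((∀ j, 0 ≤ u j) ∧ u ≠ 0)} = 0 ∧
    (∀ s ∈ negOrthant n, Integrable (fun u => Real.exp (∑ j, s j * u j) - 1) μ) ∧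
    ∀ s ∈ negOrthant n, ψ s = c₀ + ∑ j, c₁ j * s j +
      ∫ u, (Real.exp (∑ j, s j * u j) - 1) ∂μ

/-- The family of bounded positive measures `ν_t` on `ℝ₊ⁿ` with
`∫ e^{s·u} dν_t(u) = e^{t ψ(s)}` (multidimensional Bernstein–Widder). -/
def IsSubordinator (n : ℕ) (ψ : (Fin n → ℝ) → ℝ) (ν : ℝ → Measure (Fin n → ℝ)) : Prop :=
  ∀ t : ℝ, 0 ≤ t → IsFiniteMeasure (ν t) ∧ (ν t) {u | ¬ ∀ j, 0 ≤ u j} = 0 ∧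
    ∀ s ∈ negOrthant n, ∫ u, Real.exp (∑ j, s j * u j) ∂(ν t) = Real.exp (t * ψ s)

/-- The holomorphic (complex) extension `ψ(λ) = c₀ + c₁·λ + ∫ (e^{λ·u} - 1) dμ(u)`
of a Bernstein function with representation `(c₀, c₁, μ)` to `{Re λ ≤ 0} ⊆ ℂⁿ`. -/
def psiC (n : ℕ) (c₀ : ℝ) (c₁ : Fin n → ℝ) (μ : Measure (Fin n → ℝ))
    (l : Fin n → ℂ) : ℂ :=
  (c₀ : ℂ) + ∑ j, (c₁ j : ℂ) * l j +
    ∫ u, (Complex.exp (∑ j, l j * (u j : ℂ)) - 1) ∂μ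

/-- The joint point spectrum of the tuple of generators of the semigroups `T j`. -/
def JointPointSpectrum {X : Type*} [NormedAddCommGroup X] [NormedSpace ℂ X] {n : ℕ}
    (T : Fin n → ℝ → X →L[ℂ] X) : Set (Fin n → ℂ) :=
  {l | ∃ x : X, x ≠ 0 ∧ ∀ j, InGenDomain (T j) x (l j • x)}

/-- The joint approximate point spectrum of the tuple of generators of the `T j`. -/
def JointApproxSpectrum {X : Type*} [NormedAddCommGroup X] [NormedSpace ℂ X] {n : ℕ}
    (T : Fin n → ℝ → X →L[ℂ] X) : Set (Fin n → ℂ) :=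
  {l | ∃ (x : ℕ → X) (y : Fin n → ℕ → X), (∀ m, ‖x m‖ = 1) ∧
    (∀ j m, InGenDomain (T j) (x m) (y j m)) ∧
    ∀ j, Tendsto (fun m => ‖y j m - l j • x m‖) atTop (𝓝 0)}

/-- The joint residual spectrum of the tuple of generators of the `T j`:
those `λ ∈ ℂⁿ` for which `Σⱼ Im (λⱼ - Aⱼ)` is not dense in `X`. -/
def JointResidualSpectrum {X : Type*} [NormedAddCommGroup X] [NormedSpace ℂ X] {n : ℕ}
    (T : Fin n → ℝ → X →L[ℂ] X) : Set (Fin n → ℂ) :=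
  {l | ¬ Dense (↑(Submodule.span ℂ
      (⋃ j, {z : X | ∃ x y, InGenDomain (T j) x y ∧ z = l j • x - y})) : Set X)}

/-- The point spectrum of a (possibly unbounded) operator given by its graph
relation `R x y ↔ (x ∈ D(B) ∧ B x = y)`. -/
def PointSpec {X : Type*} [NormedAddCommGroup X] [NormedSpace ℂ X]
    (R : X → X → Prop) : Set ℂ :=
  {α | ∃ x : X, x ≠ 0 ∧ R x (α • x)}

/-- The approximate point spectrum of an operator given by its graph relation. -/
def ApproxSpec {X : Type*} [NormedAddCommGroup X] [NormedSpace ℂ X]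
    (R : X → X → Prop) : Set ℂ :=
  {α | ∃ x y : ℕ → X, (∀ m, ‖x m‖ = 1) ∧ (∀ m, R (x m) (y m)) ∧
    Tendsto (fun m => ‖y m - α • x m‖) atTop (𝓝 0)}

/-- The residual spectrum of an operator given by its graph relation:
those `α` for which `Im (α - B)` is not dense. -/
def ResidualSpec {X : Type*} [NormedAddCommGroup X] [NormedSpace ℂ X]
    (R : X → X → Prop) : Set ℂ :=
  {α | ¬ Dense (↑(Submodule.span ℂ {z : X | ∃ x y, R x y ∧ z = α • x - y}) : Set X)}

/-- The resolvent set of a closed operator given by its graph relation: `α` such that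
`α - B : D(B) → X` has a bounded everywhere-defined inverse. -/
def ResolventSet {X : Type*} [NormedAddCommGroup X] [NormedSpace ℂ X]
    (R : X → X → Prop) : Set ℂ :=
  {α | ∃ Rv : X →L[ℂ] X, (∀ z : X, R (Rv z) (α • Rv z - z)) ∧
    ∀ x y : X, R x y → Rv (α • x - y) = x}

/-- The constant `K_M = (M+1)/(1 - e^{-(M+1)/M})` from the moment inequality. -/
def KM (M : ℝ) : ℝ := (M + 1) / (1 - Real.exp (-(M + 1) / M))

/-- The open sector `{z ≠ 0 : |arg z| < θ}` in `ℂ`. -/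
def Sector (θ : ℝ) : Set ℂ := {z | z ≠ 0 ∧ |Complex.arg z| < θ}

/-- A `C₀`-semigroup is holomorphic if it extends to a holomorphic semigroup on some
open sector around the positive half axis, strongly continuous at `0` in the sector. -/
def IsHolomorphicSemigroup {X : Type*} [NormedAddCommGroup X] [NormedSpace ℂ X]
    (T : ℝ → X →L[ℂ] X) : Prop :=
  ∃ (θ : ℝ) (S : ℂ → X →L[ℂ] X), 0 < θ ∧ (∀ t : ℝ, 0 < t → S t = T t) ∧
    (∀ z w : ℂ, z ∈ Sector θ → w ∈ Sector θ → S (z + w) = S z ∘L S w) ∧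
    DifferentiableOn ℂ S (Sector θ) ∧
    ∀ x : X, Tendsto (fun z => S z x) (𝓝[Sector θ] 0) (𝓝 x)

end

section HelperSemigroup

variable {X : Type*} [NormedAddCommGroup X] [NormedSpace ℂ X]

theorem aux_sg_continuousOn {T : ℝ → X →L[ℂ] X} (hT : IsC0Semigroup T) {M : ℝ}
    (hM : ∀ t, 0 ≤ t → ‖T t‖ ≤ M) (x : X) : ContinuousOn (fun t => T t x) (Set.Ici 0) := by
  obtain ⟨h0, hadd, hlim⟩ := hT
  have hM0 : 0 ≤ M := (norm_nonneg _).trans (hM 0 le_rfl)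
  have key : ∀ s t : ℝ, 0 ≤ s → 0 ≤ t → ‖T s x - T t x‖ ≤ M * ‖T |s - t| x - x‖ := by
    have main : ∀ s t : ℝ, 0 ≤ s → s ≤ t → ‖T t x - T s x‖ ≤ M * ‖T (t - s) x - x‖ := by
      intro s t hs hst
      have : T t x - T s x = T s (T (t - s) x - x) := by
        have h := hadd s (t - s) hs (by linarith)
        rw [show s + (t - s) = t by ring] at h
        rw [h]; simp
      rw [this]
      exact (T s).le_of_opNorm_le (hM s hs) _
    intro s t hs ht
    rcases le_total s t with h | h
    · rw [norm_sub_rev, abs_sub_comm, abs_of_nonneg (by linarith)]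
      exact main s t hs h
    · rw [abs_of_nonneg (by linarith)]
      exact main t s ht h
  intro t ht
  have ht' : (0:ℝ) ≤ t := ht
  rw [ContinuousWithinAt, tendsto_iff_norm_sub_tendsto_zero]
  have h1 : Tendsto (fun s : ℝ => |s - t|) (𝓝[Set.Ici 0] t) (𝓝[≥] 0) := by
    refine tendsto_nhdsWithin_iff.2 ⟨?_, Eventually.of_forall fun s => Set.mem_Ici.2 (abs_nonneg _)⟩
    have : Continuous (fun s : ℝ => |s - t|) := by fun_prop
    have h := this.tendsto t
    simp only [sub_self, abs_zero] at h
    exact h.mono_left nhdsWithin_le_nhds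
  have h2 := (hlim x).comp h1
  have h3 : Tendsto (fun s : ℝ => M * ‖T |s - t| x - x‖) (𝓝[Set.Ici 0] t) (𝓝 0) := by
    have := (tendsto_iff_norm_sub_tendsto_zero.1 h2).const_mul M
    simpa using this
  refine squeeze_zero' (Eventually.of_forall fun s => norm_nonneg _) ?_ h3
  filter_upwards [self_mem_nhdsWithin] with s hs
  exact key s t hs ht'

theorem aux_sg_rightderiv {T : ℝ → X →L[ℂ] X} (hT : IsC0Semigroup T) {x y : X}
    (hxy : InGenDomain T x y) {t : ℝ} (ht : 0 ≤ t) :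
    HasDerivWithinAt (fun s => T s x) (T t y) (Set.Ici t) t := by
  rw [← hasDerivWithinAt_Ioi_iff_Ici, hasDerivWithinAt_iff_tendsto_slope' (by simp)]
  have h1 : Tendsto (fun s : ℝ => s - t) (𝓝[>] t) (𝓝[>] 0) := by
    refine tendsto_nhdsWithin_iff.2 ⟨?_, ?_⟩
    · have : Continuous (fun s : ℝ => s - t) := by fun_prop
      have h := this.tendsto t
      simp only [sub_self] at h
      exact h.mono_left nhdsWithin_le_nhds
    · filter_upwards [self_mem_nhdsWithin] with s hs
      simpa using hs
  have h2 := ((T t).continuous.tendsto y).comp (hxy.comp h1)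
  refine h2.congr' ?_
  filter_upwards [self_mem_nhdsWithin] with s hs
  have hs' : t < s := hs
  have h := hT.2.1 t (s - t) ht (by linarith)
  rw [show t + (s - t) = s by ring] at h
  simp only [slope, Function.comp, vsub_eq_sub, h]
  rw [ContinuousLinearMap.map_smul_of_tower]
  simp

theorem aux_sg_estimate {T : ℝ → X →L[ℂ] X} (hT : IsC0Semigroup T) {M : ℝ}
    (hM : ∀ t, 0 ≤ t → ‖T t‖ ≤ M) {x y : X} (hxy : InGenDomain T x y) (l : ℂ) {t : ℝ}
    (ht : 0 ≤ t) :
    ‖T t x - Complex.exp (l * t) • x‖ ≤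
      Real.exp (‖l‖ * t) * (Real.exp (‖l‖ * t) * (M * ‖y - l • x‖) * t) := by
  have hM0 : 0 ≤ M := (norm_nonneg _).trans (hM 0 le_rfl)
  have hexp : ∀ c : ℂ, ‖c‖ = ‖l‖ → ∀ s : ℝ, 0 ≤ s → s ≤ t → 
      ‖Complex.exp (c * s)‖ ≤ Real.exp (‖l‖ * t) := by
    intro c hc s hs hst
    refine (Complex.norm_exp_le_exp_norm _).trans (Real.exp_le_exp.2 ?_)
    rw [norm_mul, hc, Complex.norm_real, Real.norm_of_nonneg hs]
    gcongr
  let f : ℝ → X := fun s => Complex.exp (-l * s) • T s x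
  have hcexp : Continuous (fun s : ℝ => Complex.exp (-l * s)) := by fun_prop
  have hf : ContinuousOn f (Set.Icc 0 t) :=
    hcexp.continuousOn.smul ((aux_sg_continuousOn hT hM x).mono Set.Icc_subset_Ici_self)
  have hd : ∀ s ∈ Set.Ico 0 t, HasDerivWithinAt f
      (Complex.exp (-l * s) • T s (y - l • x)) (Set.Ici s) s := by
    intro s hs
    have e1 : HasDerivAt (fun s : ℝ => Complex.exp (-l * s)) (Complex.exp (-l * s) * (-l)) s := by
      have h0 : HasDerivAt (fun s : ℝ => -l * (s:ℂ)) (-l) s := by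
        simpa using (Complex.ofRealCLM.hasDerivAt (x := s)).const_mul (-l)
      exact h0.cexp
    have := e1.hasDerivWithinAt.smul (aux_sg_rightderiv hT hxy hs.1)
    refine this.congr_deriv ?_
    rw [map_sub, map_smul, smul_sub, smul_smul]
    module
  have := norm_image_sub_le_of_norm_deriv_right_le_segment hf hd
    (C := Real.exp (‖l‖ * t) * (M * ‖y - l • x‖)) (by
      intro s hs
      rw [norm_smul]
      gcongr
      · exact hexp _ (by simp) s hs.1 hs.2.le
      · exact (T s).le_of_opNorm_le (hM s hs.1) _) t ⟨ht, le_rfl⟩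
  have hid : T t x - Complex.exp (l * t) • x = Complex.exp (l * t) • (f t - f 0) := by
    simp only [f, smul_sub, smul_smul, ← Complex.exp_add]
    simp [hT.1]
  rw [hid, norm_smul]
  have h2 : t - 0 = t := by ring
  rw [h2] at this
  exact mul_le_mul (hexp l rfl t ht le_rfl) this (norm_nonneg _) (Real.exp_pos _).le

theorem aux_sg_tendsto {T : ℝ → X →L[ℂ] X} (hT : IsC0Semigroup T) {M : ℝ}
    (hM : ∀ t, 0 ≤ t → ‖T t‖ ≤ M) {x y : ℕ → X} (hxy : ∀ m, InGenDomain T (x m) (y m)) (l : ℂ)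
    (hl : Tendsto (fun m => ‖y m - l • x m‖) atTop (𝓝 0)) {t : ℝ} (ht : 0 ≤ t) :
    Tendsto (fun m => T t (x m) - Complex.exp (l * t) • x m) atTop (𝓝 0) := by
  rw [tendsto_zero_iff_norm_tendsto_zero]
  refine squeeze_zero (fun m => norm_nonneg _)
    (fun m => aux_sg_estimate hT hM (hxy m) l ht) ?_
  have := (((hl.const_mul M).const_mul (Real.exp (‖l‖ * t))).mul_const t).const_mul
    (Real.exp (‖l‖ * t))
  simpa using this

theorem aux_re_nonpos {T : ℝ → X →L[ℂ] X} (hT : IsC0Semigroup T) {M : ℝ}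
    (hM : ∀ t, 0 ≤ t → ‖T t‖ ≤ M) {x y : ℕ → X} (hx : ∀ m, ‖x m‖ = 1)
    (hxy : ∀ m, InGenDomain T (x m) (y m)) (l : ℂ)
    (hl : Tendsto (fun m => ‖y m - l • x m‖) atTop (𝓝 0)) : l.re ≤ 0 := by
  by_contra! hpos
  have hb : ∀ t : ℝ, 0 ≤ t → Real.exp (l.re * t) ≤ M := by
    intro t ht
    have h1 := (aux_sg_tendsto hT hM hxy l hl ht).norm
    rw [norm_zero] at h1
    have h2 : Tendsto (fun m => M + ‖T t (x m) - Complex.exp (l * t) • x m‖) atTop (𝓝 (M + 0)) :=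
      h1.const_add M
    rw [add_zero] at h2
    refine ge_of_tendsto' h2 fun m => ?_
    have h3 : ‖Complex.exp (l * t) • x m‖ = Real.exp (l.re * t) := by
      rw [norm_smul, hx, mul_one, Complex.norm_exp]; simp
    have h4 : ‖T t (x m)‖ ≤ M := by
      simpa [hx] using (T t).le_of_opNorm_le (hM t ht) (x m)
    have h5 := norm_sub_norm_le (Complex.exp (l * t) • x m) (T t (x m))
    rw [norm_sub_rev, h3] at h5
    linarith
  have hM0 : 0 ≤ M := (norm_nonneg _).trans (hM 0 le_rfl)
  have := hb (M / l.re) (by positivity)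
  rw [mul_div_cancel₀ _ hpos.ne'] at this
  linarith [Real.add_one_le_exp M]

theorem aux_list_tendsto {x : ℕ → X} (L : List ((X →L[ℂ] X) × ℂ))
    (h : ∀ p ∈ L, Tendsto (fun m => p.1 (x m) - p.2 • x m) atTop (𝓝 0)) :
    Tendsto (fun m => (L.map Prod.fst).prod (x m) - (L.map Prod.snd).prod • x m) atTop (𝓝 0) := by
  induction L with
  | nil => simp
  | cons p L ih =>
    have ih' := ih fun q hq => h q (List.mem_cons_of_mem _ hq)
    have hp := h p List.mem_cons_self
    have h1 := (p.1.continuous.tendsto 0).comp ih'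
    have h2 := (hp.const_smul (L.map Prod.snd).prod)
    rw [map_zero] at h1
    have h3 := h1.add h2
    simp only [smul_zero, add_zero] at h3
    refine h3.congr fun m => ?_
    simp only [Function.comp, List.map_cons, List.prod_cons, map_sub, map_smul,
      ContinuousLinearMap.mul_def, ContinuousLinearMap.comp_apply, smul_sub, smul_smul]
    rw [mul_comm p.2]
    abel

theorem aux_Tprod_tendsto {n : ℕ} {T : Fin n → ℝ → X →L[ℂ] X} {M : Fin n → ℝ}
    (hT : ∀ j, IsC0Semigroup (T j)) (hM : ∀ j t, 0 ≤ t → ‖T j t‖ ≤ M j)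
    {x : ℕ → X} {y : Fin n → ℕ → X} (hxy : ∀ j m, InGenDomain (T j) (x m) (y j m))
    (l : Fin n → ℂ) (hl : ∀ j, Tendsto (fun m => ‖y j m - l j • x m‖) atTop (𝓝 0))
    {u : Fin n → ℝ} (hu : ∀ j, 0 ≤ u j) :
    Tendsto (fun m => Tprod T u (x m) - Complex.exp (∑ j, l j * u j) • x m) atTop (𝓝 0) := by
  have := aux_list_tendsto (x := x) (List.ofFn fun j => (T j (u j), Complex.exp (l j * u j))) (by
    intro p hp
    rw [List.mem_ofFn] at hp
    obtain ⟨j, rfl⟩ := hp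
    exact aux_sg_tendsto (hT j) (hM j) (hxy j) (l j) (hl j) (hu j))
  simp only [List.map_ofFn, List.prod_ofFn (f := _ ∘ _)] at this
  rw [Complex.exp_sum, ← List.prod_ofFn]
  simpa [Tprod, List.map_ofFn, Function.comp_def, List.prod_ofFn] using this

theorem aux_list_cont {α : Type*} [TopologicalSpace α] (S : Set α)
    (L : List (α → X →L[ℂ] X))
    (h : ∀ f ∈ L, (∃ C, ∀ u ∈ S, ‖f u‖ ≤ C) ∧ ∀ x, ContinuousOn (fun u => f u x) S) :
    (∃ C, ∀ u ∈ S, ‖(L.map (fun f => f u)).prod‖ ≤ C) ∧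
      ∀ x, ContinuousOn (fun u => (L.map (fun f => f u)).prod x) S := by
  induction L with
  | nil =>
    refine ⟨⟨‖(1 : X →L[ℂ] X)‖, fun u _ => by simp⟩, fun x => ?_⟩
    simpa using continuousOn_const
  | cons f L ih =>
    obtain ⟨⟨C, hC⟩, hc⟩ := ih fun q hq => h q (List.mem_cons_of_mem _ hq)
    obtain ⟨⟨D, hD⟩, hd⟩ := h f List.mem_cons_self
    refine ⟨⟨D * C, fun u hu => ?_⟩, fun x u hu => ?_⟩
    · simp only [List.map_cons, List.prod_cons]
      refine (norm_mul_le _ _).trans ?_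
      exact mul_le_mul (hD u hu) (hC u hu) (norm_nonneg _) ((norm_nonneg _).trans (hD u hu))
    · simp only [List.map_cons, List.prod_cons, ContinuousLinearMap.mul_def,
        ContinuousLinearMap.comp_apply]
      set P : α → X →L[ℂ] X := fun u => (L.map (fun f => f u)).prod with hP
      have hPc : Tendsto (fun v => P v x) (𝓝[S] u) (𝓝 (P u x)) := hc x u hu
      have h1 : Tendsto (fun v => f v (P u x)) (𝓝[S] u) (𝓝 (f u (P u x))) := hd (P u x) u hu
      have h2 : Tendsto (fun v => f v (P v x - P u x)) (𝓝[S] u) (𝓝 0) := by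
        rw [tendsto_zero_iff_norm_tendsto_zero]
        have h3 := (tendsto_iff_norm_sub_tendsto_zero.1 hPc).const_mul D
        rw [mul_zero] at h3
        refine squeeze_zero' (Eventually.of_forall fun s => norm_nonneg _) ?_ h3
        filter_upwards [self_mem_nhdsWithin] with v hv
        exact (f v).le_of_opNorm_le (hD v hv) _
      have h4 := h2.add h1
      rw [zero_add] at h4
      refine h4.congr fun v => ?_
      simp [P]

theorem aux_Tprod_cont {n : ℕ} {T : Fin n → ℝ → X →L[ℂ] X} {M : Fin n → ℝ}
    (hT : ∀ j, IsC0Semigroup (T j)) (hM : ∀ j t, 0 ≤ t → ‖T j t‖ ≤ M j) :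
    (∃ C, ∀ u : Fin n → ℝ, (∀ j, 0 ≤ u j) → ‖Tprod T u‖ ≤ C) ∧
      ∀ x, ContinuousOn (fun u => Tprod T u x) {u | ∀ j, 0 ≤ u j} := by
  have := aux_list_cont (X := X) {u : Fin n → ℝ | ∀ j, 0 ≤ u j}
    (List.ofFn fun j => fun u : Fin n → ℝ => T j (u j)) (by
      intro f hf
      rw [List.mem_ofFn] at hf
      obtain ⟨j, rfl⟩ := hf
      refine ⟨⟨M j, fun u hu => hM j _ (hu j)⟩, fun x => ?_⟩
      exact (aux_sg_continuousOn (hT j) (hM j) x).comp (continuous_apply j).continuousOn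
        (fun u hu => hu j))
  simpa [Tprod, List.map_ofFn, Function.comp_def] using this

end HelperSemigroup

section HelperLaplace

theorem aux_frac_le {p : ℝ} (hp : 0 ≤ p) : p / (1 + p) ≤ 1 - Real.exp (-p) := by
  have h1 : Real.exp (-p) ≤ 1 / (1 + p) := by
    rw [Real.exp_neg, ← one_div]
    exact one_div_le_one_div_of_le (by linarith) (by linarith [Real.add_one_le_exp p])
  have h2 : p / (1 + p) = 1 - 1 / (1 + p) := by field_simp; ring
  linarith

theorem aux_exp_bound {w : ℂ} {K p : ℝ} (hp : 0 ≤ p) (hK : 0 ≤ K) (hw : w.re ≤ 0)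
    (hwp : ‖w‖ ≤ K * p) : ‖Complex.exp w - 1‖ ≤ (2 + 2 * K) * (1 - Real.exp (-p)) := by
  have h1 : ‖Complex.exp w - 1‖ ≤ 2 := by
    refine (norm_sub_le _ _).trans ?_
    rw [Complex.norm_exp, norm_one]
    linarith [Real.exp_le_one_iff.2 hw]
  have h2 : ‖Complex.exp w - 1‖ ≤ 2 * K * p := by
    rcases le_total ‖w‖ 1 with h | h
    · exact (Complex.norm_exp_sub_one_le h).trans (by linarith)
    · linarith
  refine le_trans ?_ (mul_le_mul_of_nonneg_left (aux_frac_le hp) (by positivity))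
  rw [mul_div_assoc', le_div_iff₀ (by positivity)]
  nlinarith

theorem aux_norm_sum {n : ℕ} {l : Fin n → ℂ} {u : Fin n → ℝ} {K : ℝ} (hl : ∀ j, ‖l j‖ ≤ K)
    (hu : ∀ j, 0 ≤ u j) : ‖∑ j, l j * (u j : ℂ)‖ ≤ K * ∑ j, u j := by
  rw [Finset.mul_sum]
  refine (norm_sum_le _ _).trans (Finset.sum_le_sum fun j _ => ?_)
  rw [norm_mul, Complex.norm_real, Real.norm_of_nonneg (hu j)]
  exact mul_le_mul_of_nonneg_right (hl j) (hu j)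

theorem aux_re_sum {n : ℕ} {l : Fin n → ℂ} {u : Fin n → ℝ} {c : ℝ} (hl : ∀ j, (l j).re ≤ c)
    (hu : ∀ j, 0 ≤ u j) : (∑ j, l j * (u j : ℂ)).re ≤ c * ∑ j, u j := by
  rw [Finset.mul_sum, Complex.re_sum]
  refine Finset.sum_le_sum fun j _ => ?_
  rw [Complex.re_mul_ofReal]
  exact mul_le_mul_of_nonneg_right (hl j) (hu j)

variable {n : ℕ} {ρ : Measure (Fin n → ℝ)}

theorem aux_base_int (hI : Integrable (fun u : Fin n → ℝ => Real.exp (∑ j, (-1 : ℝ) * u j) - 1) ρ)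
    (C : ℝ) : Integrable (fun u : Fin n → ℝ => C * (1 - Real.exp (-∑ j, u j))) ρ := by
  refine (hI.neg.const_mul C).congr (Eventually.of_forall fun u => ?_)
  simp

theorem aux_integrable (hρ : ∀ᵐ u ∂ρ, ∀ j, 0 ≤ u j)
    (hI : Integrable (fun u : Fin n → ℝ => Real.exp (∑ j, (-1 : ℝ) * u j) - 1) ρ)
    {l : Fin n → ℂ} (hl : ∀ j, (l j).re ≤ 0) :
    Integrable (fun u : Fin n → ℝ => Complex.exp (∑ j, l j * (u j : ℂ)) - 1) ρ := by
  refine (aux_base_int hI (2 + 2 * ‖l‖)).mono'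
    (Continuous.aestronglyMeasurable (by fun_prop)) ?_
  filter_upwards [hρ] with u hu
  refine aux_exp_bound (Finset.sum_nonneg fun j _ => hu j) (norm_nonneg _) ?_
    (aux_norm_sum (fun j => norm_le_pi_norm l j) hu)
  simpa using aux_re_sum hl hu

theorem aux_cont (hρ : ∀ᵐ u ∂ρ, ∀ j, 0 ≤ u j)
    (hI : Integrable (fun u : Fin n → ℝ => Real.exp (∑ j, (-1 : ℝ) * u j) - 1) ρ)
    {l : Fin n → ℂ} (hl : ∀ j, (l j).re ≤ 0) :
    Tendsto (fun ε : ℝ => ∫ u, (Complex.exp (∑ j, (l j - (ε : ℂ)) * (u j : ℂ)) - 1) ∂ρ)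
      (𝓝[>] 0) (𝓝 (∫ u, (Complex.exp (∑ j, l j * (u j : ℂ)) - 1) ∂ρ)) := by
  refine tendsto_integral_filter_of_dominated_convergence
    (fun u => (2 + 2 * (‖l‖ + 1)) * (1 - Real.exp (-∑ j, u j)))
    (Eventually.of_forall fun ε => Continuous.aestronglyMeasurable (by fun_prop)) ?_
    (aux_base_int hI _) (Eventually.of_forall fun u => ?_)
  · filter_upwards [Ioc_mem_nhdsGT (show (0:ℝ) < 1 by norm_num)] with ε hε
    filter_upwards [hρ] with u hu
    refine aux_exp_bound (Finset.sum_nonneg fun j _ => hu j) (by positivity) ?_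
      (aux_norm_sum (fun j => ?_) hu)
    · have := aux_re_sum (l := fun j => l j - (ε : ℂ)) (c := 0) (fun j => by
        have h1 := hl j
        have h2 := hε.1
        simp only [Complex.sub_re, Complex.ofReal_re]; linarith) hu
      simpa using this
    · refine (norm_sub_le _ _).trans (add_le_add (norm_le_pi_norm l j) ?_)
      rw [Complex.norm_real, Real.norm_of_nonneg hε.1.le]; exact hε.2
  · have : Continuous (fun ε : ℝ => Complex.exp (∑ j, (l j - (ε : ℂ)) * (u j : ℂ)) - 1) := by
      fun_prop
    have h := this.tendsto 0
    simp only [Complex.ofReal_zero, sub_zero] at h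
    exact h.mono_left nhdsWithin_le_nhds

theorem aux_diff (hρ : ∀ᵐ u ∂ρ, ∀ j, 0 ≤ u j)
    (hI : Integrable (fun u : Fin n → ℝ => Real.exp (∑ j, (-1 : ℝ) * u j) - 1) ρ)
    {a b : Fin n → ℝ} {δ η : ℝ} (hη : 0 < η)
    (hab : ∀ j, ∀ r : ℝ, |r| < δ → a j + r * b j ≤ -η) :
    DifferentiableOn ℂ (fun z : ℂ =>
      ∫ u, (Complex.exp (∑ j, ((a j : ℂ) + z * (b j : ℂ)) * (u j : ℂ)) - 1) ∂ρ)
      {z : ℂ | |z.re| < δ} := by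
  have hopen : IsOpen {z : ℂ | |z.re| < δ} :=
    isOpen_lt (by fun_prop) continuous_const
  have hre : ∀ z : ℂ, |z.re| < δ → ∀ j, ((a j : ℂ) + z * (b j : ℂ)).re ≤ -η := by
    intro z hz j
    simpa using hab j z.re hz
  intro z hz
  have := (hasDerivAt_integral_of_dominated_loc_of_deriv_le (μ := ρ) (𝕜 := ℂ)
    (F := fun z u => Complex.exp (∑ j, ((a j : ℂ) + z * (b j : ℂ)) * (u j : ℂ)) - 1)
    (F' := fun z u => Complex.exp (∑ j, ((a j : ℂ) + z * (b j : ℂ)) * (u j : ℂ)) *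
      ∑ j, (b j : ℂ) * (u j : ℂ))
    (bound := fun u => (‖b‖ * (1 + 1 / η)) * (1 - Real.exp (-∑ j, u j)))
    (hopen.mem_nhds hz)
    (Eventually.of_forall fun z => Continuous.aestronglyMeasurable (by fun_prop))
    (aux_integrable hρ hI (fun j => (hre z hz j).trans (by linarith)))
    (Continuous.aestronglyMeasurable (by fun_prop)) ?_ (aux_base_int hI _) ?_).2
  · exact this.differentiableAt.differentiableWithinAt
  · filter_upwards [hρ] with u hu w hw
    have hp : 0 ≤ ∑ j, u j := Finset.sum_nonneg fun j _ => hu j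
    set p := ∑ j, u j with hpdef
    rw [norm_mul, Complex.norm_exp]
    have h1 := aux_re_sum (hre w hw) hu
    rw [← hpdef] at h1
    have h2 := aux_norm_sum (l := fun j => (b j : ℂ)) (K := ‖b‖)
      (fun j => by rw [Complex.norm_real]; exact norm_le_pi_norm b j) hu
    have h3 : Real.exp (-η * p) ≤ (1 + 1 / η) / (1 + p) := by
      rw [neg_mul, Real.exp_neg, inv_le_comm₀ (Real.exp_pos _) (by positivity), inv_div]
      refine le_trans ?_ (Real.add_one_le_exp _)
      rw [div_le_iff₀ (by positivity)]
      have : (η * p + 1) * (1 + 1 / η) = η * p + 1 + p + 1 / η := by field_simp; ring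
      rw [this]
      have : 0 ≤ 1 / η := by positivity
      nlinarith [mul_nonneg hη.le hp]
    calc _ ≤ (1 + 1 / η) / (1 + p) * (‖b‖ * p) :=
          mul_le_mul ((Real.exp_le_exp.2 h1).trans h3) h2 (norm_nonneg _) (by positivity)
      _ = (‖b‖ * (1 + 1 / η)) * (p / (1 + p)) := by ring
      _ ≤ _ := mul_le_mul_of_nonneg_left (aux_frac_le hp) (by positivity)
  · refine Eventually.of_forall fun u w _ => ?_
    have h0 : HasDerivAt (fun z : ℂ => ∑ j, ((a j : ℂ) + z * (b j : ℂ)) * (u j : ℂ))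
        (∑ j, (b j : ℂ) * (u j : ℂ)) w := by
      refine HasDerivAt.fun_sum fun j _ => ?_
      simpa using (((hasDerivAt_id w).mul_const (b j : ℂ)).const_add (a j : ℂ)).mul_const (u j : ℂ)
    exact h0.cexp.sub_const 1

end HelperLaplace

theorem aux_laplace {n : ℕ} {ψ : (Fin n → ℝ) → ℝ} {c₀ : ℝ} {c₁ : Fin n → ℝ}
    {μ : Measure (Fin n → ℝ)} (hrep : HasLevyRep n ψ c₀ c₁ μ)
    {ν : ℝ → Measure (Fin n → ℝ)} (hν : IsSubordinator n ψ ν) {t : ℝ} (ht : 0 ≤ t)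
    {l : Fin n → ℂ} (hl : ∀ j, (l j).re ≤ 0) :
    ∫ u, Complex.exp (∑ j, l j * (u j : ℂ)) ∂(ν t) = Complex.exp (t * psiC n c₀ c₁ μ l) := by
  obtain ⟨-, -, hμ0, hμint, hψ⟩ := hrep
  obtain ⟨hfin, hν0, hνL⟩ := hν t ht
  have hμ : ∀ᵐ u ∂μ, ∀ j, 0 ≤ u j := by
    have : ∀ᵐ u ∂μ, (∀ j, 0 ≤ u j) ∧ u ≠ 0 := hμ0
    exact this.mono fun u hu => hu.1
  have hνa : ∀ᵐ u ∂(ν t), ∀ j, 0 ≤ u j := hν0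
  have hμI := hμint (fun _ => -1) (fun j => by norm_num)
  have hνI : Integrable (fun u : Fin n → ℝ => Real.exp (∑ j, (-1 : ℝ) * u j) - 1) (ν t) := by
    refine (integrable_const (1 : ℝ)).mono' (Continuous.aestronglyMeasurable (by fun_prop)) ?_
    filter_upwards [hνa] with u hu
    have h1 : ∑ j, (-1 : ℝ) * u j ≤ 0 := by
      simpa using Finset.sum_nonneg fun j _ => hu j
    rw [Real.norm_eq_abs, abs_le]
    have := Real.exp_pos (∑ j, (-1 : ℝ) * u j)
    have := Real.exp_le_one_iff.2 h1
    constructor <;> linarith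
  have hone : ∀ l : Fin n → ℂ, (∀ j, (l j).re ≤ 0) →
      ∫ u, Complex.exp (∑ j, l j * (u j : ℂ)) ∂(ν t) =
        (∫ u, (Complex.exp (∑ j, l j * (u j : ℂ)) - 1) ∂(ν t)) + ∫ u, (1 : ℂ) ∂(ν t) := by
    intro l hl
    rw [← integral_add (aux_integrable hνa hνI hl) (integrable_const _)]
    simp
  have hreal : ∀ s ∈ negOrthant n, ∫ u, Complex.exp (∑ j, (s j : ℂ) * (u j : ℂ)) ∂(ν t) =
      Complex.exp (t * psiC n c₀ c₁ μ (fun j => (s j : ℂ))) := by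
    intro s hs
    have h1 : ∀ u : Fin n → ℝ, Complex.exp (∑ j, (s j : ℂ) * (u j : ℂ)) =
        ((Real.exp (∑ j, s j * u j) : ℝ) : ℂ) := by
      intro u; push_cast; rfl
    have h2 : psiC n c₀ c₁ μ (fun j => (s j : ℂ)) = ((ψ s : ℝ) : ℂ) := by
      rw [psiC, hψ s hs]
      have : ∀ u : Fin n → ℝ, Complex.exp (∑ j, (s j : ℂ) * (u j : ℂ)) - 1 =
        ((Real.exp (∑ j, s j * u j) - 1 : ℝ) : ℂ) := by
        intro u; push_cast; rfl
      simp_rw [this]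
      rw [integral_complex_ofReal]
      push_cast; rfl
    simp_rw [h1]
    rw [h2, integral_complex_ofReal, hνL s hs]
    push_cast; rfl
  -- interior points
  have hint : ∀ ε : ℝ, 0 < ε →
      ∫ u, Complex.exp (∑ j, (l j - (ε : ℂ)) * (u j : ℂ)) ∂(ν t) =
        Complex.exp (t * psiC n c₀ c₁ μ (fun j => l j - (ε : ℂ))) := by
    intro ε hε
    set a : Fin n → ℝ := fun j => (l j).re - ε with ha
    set b : Fin n → ℝ := fun j => (l j).im with hb
    set δ : ℝ := ε / (2 * (‖b‖ + 1)) with hδ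
    have hδ0 : 0 < δ := by positivity
    have hab : ∀ j, ∀ r : ℝ, |r| < δ → a j + r * b j ≤ -(ε / 2) := by
      intro j r hr
      have h1 : r * b j ≤ δ * (‖b‖ + 1) := by
        refine (le_abs_self _).trans ?_
        rw [abs_mul]
        refine mul_le_mul hr.le ?_ (abs_nonneg _) hδ0.le
        have := norm_le_pi_norm b j
        rw [Real.norm_eq_abs] at this
        linarith
      have h2 : δ * (‖b‖ + 1) = ε / 2 := by
        rw [hδ]; field_simp
      have h3 := hl j
      simp only [ha]
      linarith
    have hre : ∀ z : ℂ, |z.re| < δ → ∀ j, ((a j : ℂ) + z * (b j : ℂ)).re ≤ 0 := by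
      intro z hz j
      have h1 := hab j z.re hz
      have h2 : ((a j : ℂ) + z * (b j : ℂ)).re = a j + z.re * b j := by simp
      rw [h2]; linarith
    have hopen : IsOpen {z : ℂ | |z.re| < δ} :=
      isOpen_lt (by fun_prop) continuous_const
    have hconv : Convex ℝ {z : ℂ | |z.re| < δ} := by
      have : {z : ℂ | |z.re| < δ} = Complex.reLm ⁻¹' (Set.Ioo (-δ) δ) := by
        ext z; simp [abs_lt]
      rw [this]
      exact (convex_Ioo (-δ) δ).linear_preimage _
    have hd1 := aux_diff hνa hνI (half_pos hε) hab
    have hd2 := aux_diff hμ hμI (half_pos hε) hab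
    have hF : DifferentiableOn ℂ (fun z : ℂ =>
        (∫ u, (Complex.exp (∑ j, ((a j : ℂ) + z * (b j : ℂ)) * (u j : ℂ)) - 1) ∂(ν t))
          + ∫ u, (1 : ℂ) ∂(ν t)) {z : ℂ | |z.re| < δ} := hd1.add_const _
    have hG : DifferentiableOn ℂ (fun z : ℂ =>
        Complex.exp (t * psiC n c₀ c₁ μ (fun j => (a j : ℂ) + z * (b j : ℂ))))
          {z : ℂ | |z.re| < δ} := by
      unfold psiC
      refine DifferentiableOn.cexp (DifferentiableOn.const_mul (DifferentiableOn.add ?_ hd2) _)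
      exact Differentiable.differentiableOn (by fun_prop)
    have hfreq : ∃ᶠ z : ℂ in 𝓝[≠] 0,
        (∫ u, (Complex.exp (∑ j, ((a j : ℂ) + z * (b j : ℂ)) * (u j : ℂ)) - 1) ∂(ν t))
          + ∫ u, (1 : ℂ) ∂(ν t) =
        Complex.exp (t * psiC n c₀ c₁ μ (fun j => (a j : ℂ) + z * (b j : ℂ))) := by
      have htend : Tendsto (fun r : ℝ => (r : ℂ)) (𝓝[≠] 0) (𝓝[≠] 0) := by
        refine tendsto_nhdsWithin_iff.2 ⟨?_, ?_⟩
        · have h := Complex.continuous_ofReal.tendsto 0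
          simp only [Complex.ofReal_zero] at h
          exact h.mono_left nhdsWithin_le_nhds
        · filter_upwards [self_mem_nhdsWithin] with r hr
          simpa using hr
      refine htend.frequently (Eventually.frequently ?_)
      have : ∀ᶠ r : ℝ in 𝓝[≠] 0, |r| < δ := by
        refine nhdsWithin_le_nhds ?_
        have hc : Continuous (fun r : ℝ => |r|) := continuous_abs
        exact (isOpen_lt hc continuous_const).mem_nhds (by simpa using hδ0)
      filter_upwards [this] with r hr
      rw [← hone _ (hre (r : ℂ) (by simpa using hr))]
      have h1 := hreal (fun j => a j + r * b j) (fun j => by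
        have := hab j r hr
        show a j + r * b j < 0
        linarith)
      push_cast at h1
      exact h1
    have hEq := (hF.analyticOnNhd hopen).eqOn_of_preconnected_of_frequently_eq
      (hG.analyticOnNhd hopen) hconv.isPreconnected (by simpa using hδ0) hfreq
    have hI : Complex.I ∈ {z : ℂ | |z.re| < δ} := by simpa using hδ0
    have h1 := hEq hI
    simp only at h1
    rw [← hone _ (hre _ hI)] at h1
    have h2 : ∀ j, (a j : ℂ) + Complex.I * (b j : ℂ) = l j - (ε : ℂ) := by
      intro j
      apply Complex.ext <;> simp [ha, hb]
    simp only [h2] at h1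
    exact h1
  have hL : Tendsto (fun ε : ℝ => ∫ u, Complex.exp (∑ j, (l j - (ε : ℂ)) * (u j : ℂ)) ∂(ν t))
      (𝓝[>] 0) (𝓝 (∫ u, Complex.exp (∑ j, l j * (u j : ℂ)) ∂(ν t))) := by
    rw [hone l hl]
    refine ((aux_cont hνa hνI hl).add_const _).congr' ?_
    filter_upwards [self_mem_nhdsWithin] with ε hε
    rw [hone]
    intro j
    have h1 := hl j
    have h2 : 0 < ε := hε
    simp only [Complex.sub_re, Complex.ofReal_re]; linarith
  have hR : Tendsto (fun ε : ℝ => Complex.exp (t * psiC n c₀ c₁ μ (fun j => l j - (ε : ℂ))))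
      (𝓝[>] 0) (𝓝 (Complex.exp (t * psiC n c₀ c₁ μ l))) := by
    refine (Complex.continuous_exp.tendsto _).comp (Tendsto.const_mul _ ?_)
    unfold psiC
    refine Tendsto.add ?_ (aux_cont hμ hμI hl)
    have hc : Continuous (fun ε : ℝ => (c₀ : ℂ) + ∑ j, (c₁ j : ℂ) * (l j - (ε : ℂ))) := by
      fun_prop
    have h := hc.tendsto 0
    simp only [Complex.ofReal_zero, sub_zero] at h
    exact h.mono_left nhdsWithin_le_nhds
  refine tendsto_nhds_unique (hL.congr' ?_) hR
  filter_upwards [self_mem_nhdsWithin] with ε hε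
  exact hint ε hε

section HelperAverage

variable {X : Type*} [NormedAddCommGroup X] [NormedSpace ℂ X] [CompleteSpace X]

theorem aux_average {g : ℝ → X →L[ℂ] X} (hg : IsC0Semigroup g) {C : ℝ}
    (hC : ∀ t, 0 ≤ t → ‖g t‖ ≤ C) (α : ℂ) (x : X) :
    InGenDomain g (∫ t in (0:ℝ)..1, Complex.exp (-α * t) • g t x)
      (α • (∫ t in (0:ℝ)..1, Complex.exp (-α * t) • g t x)
        + (Complex.exp (-α) • g 1 x - x)) := by
  set K : ℝ → X := fun t => Complex.exp (-α * t) • g (max t 0) x with hK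
  have hKc : Continuous K := by
    have h1 : Continuous (fun t : ℝ => g (max t 0) x) :=
      (aux_sg_continuousOn hg hC x).comp_continuous (by fun_prop)
        (fun t => Set.mem_Ici.2 (le_max_right _ _))
    have h2 : Continuous (fun t : ℝ => Complex.exp (-α * t)) := by fun_prop
    exact h2.smul h1
  have hKi : ∀ a b : ℝ, IntervalIntegrable K volume a b := fun a b => hKc.intervalIntegrable a b
  have hz : (∫ t in (0:ℝ)..1, Complex.exp (-α * t) • g t x) = ∫ t in (0:ℝ)..1, K t := by
    refine intervalIntegral.integral_congr fun t ht => ?_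
    rw [Set.uIcc_of_le zero_le_one] at ht
    simp only [hK, max_eq_left ht.1]
  rw [hz]
  set z := ∫ t in (0:ℝ)..1, K t with hzdef
  set F : ℝ → X := fun s => ∫ t in (0:ℝ)..s, K t with hF
  have hFd : ∀ s, HasDerivAt F (K s) s := fun s =>
    intervalIntegral.integral_hasDerivAt_right (hKi 0 s)
      hKc.aestronglyMeasurable.stronglyMeasurableAtFilter hKc.continuousAt
  -- main identity
  have hid : ∀ h : ℝ, 0 ≤ h → g h z = Complex.exp (α * h) • (F (1 + h) - F h) := by
    intro h hh
    have h1 : g h z = ∫ t in (0:ℝ)..1, g h (K t) :=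
      ((g h).intervalIntegral_comp_comm (hKi 0 1)).symm
    have h2 : ∫ t in (0:ℝ)..1, g h (K t) =
        ∫ t in (0:ℝ)..1, Complex.exp (α * h) • K (t + h) := by
      refine intervalIntegral.integral_congr fun t ht => ?_
      rw [Set.uIcc_of_le zero_le_one] at ht
      have ht0 : 0 ≤ t := ht.1
      simp only [hK, max_eq_left ht0, max_eq_left (add_nonneg ht0 hh), map_smul, smul_smul,
        ← Complex.exp_add]
      rw [add_comm t h, hg.2.1 h t hh ht0]
      simp only [ContinuousLinearMap.comp_apply]
      congr 2
      push_cast; ring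
    rw [h1, h2, intervalIntegral.integral_smul, intervalIntegral.integral_comp_add_right K h]
    rw [zero_add, ← intervalIntegral.integral_interval_sub_left (hKi 0 (1 + h)) (hKi 0 h)]
  have hR : HasDerivAt (fun h : ℝ => Complex.exp (α * h) • (F (1 + h) - F h))
      (α • z + (K 1 - K 0)) 0 := by
    have e1 : HasDerivAt (fun s : ℝ => Complex.exp (α * s)) α 0 := by
      have h0 : HasDerivAt (fun s : ℝ => α * (s:ℂ)) α 0 := by
        simpa using (Complex.ofRealCLM.hasDerivAt (x := (0:ℝ))).const_mul α
      simpa using h0.cexp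
    have e2 : HasDerivAt (fun h : ℝ => F (1 + h)) (K 1) 0 := by
      have := (hFd (1 + 0)).comp_const_add 1 0
      simpa using this
    have e3 := e1.smul (e2.sub (hFd 0))
    refine e3.congr_deriv ?_
    simp [F, hzdef, add_comm]
  have hK1 : K 1 = Complex.exp (-α) • g 1 x := by simp [hK]
  have hK0 : K 0 = x := by simp [hK, hg.1]
  rw [← hK1, show K 1 - x = K 1 - K 0 by rw [hK0]]
  have hs := hR.hasDerivWithinAt (s := Set.Ioi 0)
  rw [hasDerivWithinAt_iff_tendsto_slope' (by simp)] at hs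
  refine hs.congr' ?_
  filter_upwards [self_mem_nhdsWithin] with h hh
  have hh' : (0:ℝ) < h := hh
  rw [hid h hh'.le]
  simp [slope, F, hzdef]

theorem aux_final {g : ℝ → X →L[ℂ] X} (hg : IsC0Semigroup g) {C : ℝ}
    (hC : ∀ t, 0 ≤ t → ‖g t‖ ≤ C) (α : ℂ) {x : ℕ → X} (hx : ∀ m, ‖x m‖ = 1)
    (hlim : ∀ t : ℝ, 0 ≤ t →
      Tendsto (fun m => g t (x m) - Complex.exp (t * α) • x m) atTop (𝓝 0)) :
    α ∈ ApproxSpec (fun x y : X => InGenDomain g x y) := by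
  have hC0 : 0 ≤ C := (norm_nonneg _).trans (hC 0 le_rfl)
  have hlim' : ∀ t : ℝ, 0 ≤ t →
      Tendsto (fun m => Complex.exp (-α * t) • g t (x m) - x m) atTop (𝓝 0) := by
    intro t ht
    have := (hlim t ht).const_smul (Complex.exp (-α * t))
    rw [smul_zero] at this
    refine this.congr fun m => ?_
    rw [smul_sub, smul_smul, ← Complex.exp_add]
    have : -α * t + t * α = 0 := by ring
    rw [this]; simp
  have hcexp : Continuous (fun s : ℝ => Complex.exp (-α * s)) := by fun_prop
  have hcont : ∀ m, ContinuousOn (fun t : ℝ => Complex.exp (-α * t) • g t (x m))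
      (Set.uIcc 0 1) := by
    intro m
    rw [Set.uIcc_of_le zero_le_one]
    exact hcexp.continuousOn.smul
      ((aux_sg_continuousOn hg hC (x m)).mono Set.Icc_subset_Ici_self)
  set z : ℕ → X := fun m => ∫ t in (0:ℝ)..1, Complex.exp (-α * t) • g t (x m) with hz
  have hzx : Tendsto (fun m => z m - x m) atTop (𝓝 0) := by
    have h1 : ∀ m, z m - x m =
        ∫ t in (0:ℝ)..1, (Complex.exp (-α * t) • g t (x m) - x m) := by
      intro m
      rw [intervalIntegral.integral_sub (hcont m).intervalIntegrable (by simp)]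
      simp [hz]
    simp_rw [h1]
    have := intervalIntegral.tendsto_integral_filter_of_dominated_convergence (μ := volume)
      (a := 0) (b := 1) (l := atTop)
      (F := fun m t => Complex.exp (-α * t) • g t (x m) - x m) (f := fun _ => (0 : X))
      (fun _ => Real.exp ‖α‖ * C + 1) ?_ ?_ (by simp) ?_
    · simpa using this
    · refine Eventually.of_forall fun m => ?_
      exact (((hcont m).mono Set.uIoc_subset_uIcc).sub continuousOn_const).aestronglyMeasurable
        measurableSet_uIoc
    · refine Eventually.of_forall fun m => Eventually.of_forall fun t ht => ?_
      rw [Set.uIoc_of_le zero_le_one] at ht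
      refine (norm_sub_le _ _).trans (add_le_add ?_ (hx m).le)
      rw [norm_smul]
      refine mul_le_mul ?_ ?_ (norm_nonneg _) (Real.exp_pos _).le
      · refine (Complex.norm_exp_le_exp_norm _).trans (Real.exp_le_exp.2 ?_)
        rw [norm_mul, norm_neg, Complex.norm_real, Real.norm_of_nonneg ht.1.le]
        exact mul_le_of_le_one_right (norm_nonneg _) ht.2
      · simpa [hx] using (g t).le_of_opNorm_le (hC t ht.1.le) (x m)
    · refine Eventually.of_forall fun t ht => ?_
      rw [Set.uIoc_of_le zero_le_one] at ht
      exact hlim' t ht.1.le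
  have hev : ∀ᶠ m in atTop, (1/2 : ℝ) ≤ ‖z m‖ := by
    have h1 := hzx.norm
    rw [norm_zero] at h1
    filter_upwards [h1.eventually_le_const (show (0:ℝ) < 1/2 by norm_num)] with m hm
    have := norm_sub_norm_le (x m) (z m)
    rw [norm_sub_rev, hx] at this
    linarith
  obtain ⟨N, hN⟩ := eventually_atTop.1 hev
  have hdom := fun m => aux_average hg hC α (x m)
  set v : ℕ → X := fun m => Complex.exp (-α) • g 1 (x m) - x m with hv
  have hv0 : Tendsto v atTop (𝓝 0) := by
    have := hlim' 1 zero_le_one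
    simpa using this
  refine ⟨fun m => ((‖z (m + N)‖⁻¹ : ℝ) : ℂ) • z (m + N),
    fun m => ((‖z (m + N)‖⁻¹ : ℝ) : ℂ) • (α • z (m + N) + v (m + N)), ?_, ?_, ?_⟩
  · intro m
    have := hN (m + N) (by omega)
    rw [norm_smul, Complex.norm_real, norm_inv, norm_norm]
    exact inv_mul_cancel₀ (by linarith)
  · intro m
    have h1 := Tendsto.const_smul (hdom (m + N)) ((‖z (m + N)‖⁻¹ : ℝ) : ℂ)
    refine h1.congr fun t => ?_
    rw [map_smul, ← smul_sub, smul_comm]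
  · have h1 : Tendsto (fun m => 2 * ‖v (m + N)‖) atTop (𝓝 0) := by
      have := (((tendsto_add_atTop_iff_nat N).2 hv0).norm).const_mul 2
      simpa using this
    refine squeeze_zero (fun m => norm_nonneg _) (fun m => ?_) h1
    have h2 := hN (m + N) (by omega)
    beta_reduce
    rw [smul_add, smul_comm _ α, add_sub_cancel_left, norm_smul, Complex.norm_real, norm_inv,
      norm_norm]
    refine mul_le_mul_of_nonneg_right ?_ (norm_nonneg _)
    rw [inv_le_comm₀ (by linarith) (by norm_num)]
    linarith

end HelperAverage
/-- Assume either that `σ_a(Aⱼ) ⊆ {Re z < 0}` for all `j`, or that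
the limit of `∂ψ/∂sⱼ` at the origin is finite for all `j`. Then `ψ` maps the joint
approximate point spectrum of `A` into the approximate point spectrum of `ψ(A)`:
`σ_a(ψ(A)) ⊇ ψ(σ_a(A))`. -/
theorem image_jointApproxSpectrum_subset_approxSpec
    {X : Type*} [NormedAddCommGroup X] [NormedSpace ℂ X] [CompleteSpace X]
    {n : ℕ} (T : Fin n → ℝ → X →L[ℂ] X) (M : Fin n → ℝ)
    (hT : ∀ j, IsC0Semigroup (T j)) (hM : ∀ j t, 0 ≤ t → ‖T j t‖ ≤ M j)
    (hcomm : ∀ i j s t, 0 ≤ s → 0 ≤ t → T i s ∘L T j t = T j t ∘L T i s)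
    (ψ : (Fin n → ℝ) → ℝ) (c₀ : ℝ) (c₁ : Fin n → ℝ) (μ : MeasureTheory.Measure (Fin n → ℝ))
    (hψ : MemTn n ψ) (hrep : HasLevyRep n ψ c₀ c₁ μ)
    (ν : ℝ → MeasureTheory.Measure (Fin n → ℝ)) (hν : IsSubordinator n ψ ν)
    (g : ℝ → X →L[ℂ] X) (hgsem : IsC0Semigroup g)
    (hg : ∀ t, 0 ≤ t → ∀ x : X, g t x = ∫ u, Tprod T u x ∂(ν t))
    (halt : (∀ j, ∀ z ∈ ApproxSpec (fun x y : X => InGenDomain (T j) x y), z.re < 0) ∨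
      (∀ j, ∃ L : ℝ, Tendsto
        (fun s => fderivWithin ℝ ψ (negOrthant n) s (Pi.single j 1))
        (𝓝[negOrthant n] 0) (𝓝 L))) :
    psiC n c₀ c₁ μ '' JointApproxSpectrum T
      ⊆ ApproxSpec (fun x y : X => InGenDomain g x y) := by
  rintro _ ⟨l, ⟨x, y, hx, hxy, hl⟩, rfl⟩
  have hre : ∀ j, (l j).re ≤ 0 := fun j =>
    aux_re_nonpos (hT j) (hM j) hx (hxy j) (l j) (hl j)
  obtain ⟨⟨C, hC⟩, hcont⟩ := aux_Tprod_cont hT hM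
  have hC0 : 0 ≤ C := (norm_nonneg _).trans (hC 0 (fun j => le_rfl))
  have hmeasS : MeasurableSet {u : Fin n → ℝ | ∀ j, 0 ≤ u j} := by
    have : IsClosed {u : Fin n → ℝ | ∀ j, 0 ≤ u j} := by
      simp only [Set.ofPred_forall]
      exact isClosed_iInter fun j => isClosed_le continuous_const (continuous_apply j)
    exact this.measurableSet
  have hae : ∀ t, 0 ≤ t → ∀ᵐ u ∂(ν t), ∀ j, 0 ≤ u j := fun t ht => (hν t ht).2.1
  have hmeas : ∀ t, 0 ≤ t → ∀ x : X, AEStronglyMeasurable (fun u => Tprod T u x) (ν t) := by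
    intro t ht x
    have h1 := (hcont x).aestronglyMeasurable (μ := ν t) hmeasS
    rwa [Measure.restrict_eq_self_of_ae_mem (s := {u : Fin n → ℝ | ∀ j, 0 ≤ u j}) (hae t ht)] at h1
  have hint : ∀ t, 0 ≤ t → ∀ x : X, Integrable (fun u => Tprod T u x) (ν t) := by
    intro t ht x
    have := (hν t ht).1
    refine (integrable_const (C * ‖x‖)).mono' (hmeas t ht x) ?_
    filter_upwards [hae t ht] with u hu
    exact (Tprod T u).le_of_opNorm_le (hC u hu) x
  have hmass : ∀ t, 0 ≤ t → (ν t).real Set.univ ≤ 1 := by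
    intro t ht
    have h1 := aux_laplace hrep hν ht (l := fun _ => 0) (fun j => by simp)
    have h2 : psiC n c₀ c₁ μ (fun _ => 0) = c₀ := by simp [psiC]
    rw [h2] at h1
    simp only [zero_mul, Finset.sum_const_zero, Complex.exp_zero, integral_const] at h1
    have h3 : (ν t).real Set.univ = Real.exp (t * c₀) := by
      have : (((ν t).real Set.univ : ℝ) : ℂ) = ((Real.exp (t * c₀) : ℝ) : ℂ) := by
        push_cast
        simpa using h1
      exact_mod_cast this
    rw [h3, Real.exp_le_one_iff]
    exact mul_nonpos_of_nonneg_of_nonpos ht hrep.1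
  have hgb : ∀ t, 0 ≤ t → ‖g t‖ ≤ C := by
    intro t ht
    have := (hν t ht).1
    refine ContinuousLinearMap.opNorm_le_bound _ hC0 fun x => ?_
    rw [hg t ht]
    refine (norm_integral_le_of_norm_le_const (C := C * ‖x‖) ?_).trans ?_
    · filter_upwards [hae t ht] with u hu
      exact (Tprod T u).le_of_opNorm_le (hC u hu) x
    · exact mul_le_of_le_one_right (by positivity) (hmass t ht)
  refine aux_final hgsem hgb _ hx fun t ht => ?_
  have hfin := (hν t ht).1
  have hnorm : ∀ u : Fin n → ℝ, (∀ j, 0 ≤ u j) →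
      ‖Complex.exp (∑ j, l j * (u j : ℂ))‖ ≤ 1 := by
    intro u hu
    rw [Complex.norm_exp, Real.exp_le_one_iff]
    simpa using aux_re_sum hre hu
  have hcE : Continuous (fun u : Fin n → ℝ => Complex.exp (∑ j, l j * (u j : ℂ))) := by fun_prop
  have hEint : Integrable (fun u : Fin n → ℝ => Complex.exp (∑ j, l j * (u j : ℂ))) (ν t) := by
    refine (integrable_const (1 : ℝ)).mono' hcE.aestronglyMeasurable ?_
    filter_upwards [hae t ht] with u hu
    exact hnorm u hu
  have hEx : ∀ m, Integrable
      (fun u : Fin n → ℝ => Complex.exp (∑ j, l j * (u j : ℂ)) • x m) (ν t) :=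
    fun m => hEint.smul_const (x m)
  have hid : ∀ m, g t (x m) - Complex.exp (t * psiC n c₀ c₁ μ l) • x m =
      ∫ u, (Tprod T u (x m) - Complex.exp (∑ j, l j * (u j : ℂ)) • x m) ∂(ν t) := by
    intro m
    rw [integral_sub (hint t ht (x m)) (hEx m), integral_smul_const, hg t ht,
      aux_laplace hrep hν ht hre]
  simp_rw [hid]
  have := tendsto_integral_filter_of_norm_le_const (μ := ν t) (l := atTop)
    (F := fun m u => Tprod T u (x m) - Complex.exp (∑ j, l j * (u j : ℂ)) • x m)
    (f := fun _ => (0 : X))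
    (Eventually.of_forall fun m => ((hint t ht (x m)).sub (hEx m)).aestronglyMeasurable)
    ⟨C + 1, Eventually.of_forall fun m => by
      filter_upwards [hae t ht] with u hu
      refine (norm_sub_le _ _).trans (add_le_add ?_ ?_)
      · simpa [hx] using (Tprod T u).le_of_opNorm_le (hC u hu) (x m)
      · rw [norm_smul, hx, mul_one]
        exact hnorm u hu⟩
    (by
      filter_upwards [hae t ht] with u hu
      exact aux_Tprod_tendsto hT hM hxy l hl hu)
  simpa using this
end

section
/- Let ψ ∈ T_n and let A = (A₁,…,Aₙ) be pairwise commuting generators of uniformly bounded C₀-semigroups on a complex Banach space X. Assume either that σ_a(Aⱼ) ⊆ {z ∈ ℂ : Re z < 0} for all j, or that ∂ψ(−0)/∂sⱼ ≠ ∞ for all j. Then σ(ψ(A)) ⊇ ψ(σ_J(A)), where σ_J(A) = σ_a(A) ∪ σ_R(A) is the joint spectrum of A and σ(ψ(A)) is the spectrum of ψ(A). -/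
open MeasureTheory Filter Topology

namespace JS

lemma norm_exp_sub_one_le_of_re {w : ℂ} (hw : w.re ≤ 0) : ‖Complex.exp w - 1‖ ≤ ‖w‖ := by
  have h := Convex.norm_image_sub_le_of_norm_hasDerivWithin_le (f := Complex.exp)
    (f' := Complex.exp) (C := 1) (s := {c : ℂ | c.re ≤ 0}) (x := 0) (y := w)
    (fun x _ => (Complex.hasDerivAt_exp x).hasDerivWithinAt)
    (fun x hx => by
      rw [Complex.norm_exp]; exact Real.exp_le_one_iff.2 hx)
    (convex_halfSpace_re_le 0) (by simp) hw
  simpa using h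

lemma norm_exp_sub_one_le_two {w : ℂ} (hw : w.re ≤ 0) : ‖Complex.exp w - 1‖ ≤ 2 := by
  have h1 : ‖Complex.exp w‖ ≤ 1 := by rw [Complex.norm_exp]; exact Real.exp_le_one_iff.2 hw
  have := norm_sub_le (Complex.exp w) 1
  simp only [norm_one] at this
  linarith

/-- comparison weight -/
lemma frac_le {s : ℝ} (hs : 0 ≤ s) : s / (1 + s) ≤ 1 - Real.exp (-s) := by
  have h := Real.add_one_le_exp s
  have : Real.exp (-s) ≤ 1 / (1 + s) := by
    rw [Real.exp_neg, ← one_div]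
    exact one_div_le_one_div_of_le (by linarith) (by linarith)
  have h2 : s / (1 + s) = 1 - 1 / (1 + s) := by field_simp; ring
  linarith

lemma le_weight {a s K : ℝ} (hs : 0 ≤ s) (hK : 0 ≤ K) (h1 : a ≤ K * s) (h2 : a ≤ 2) :
    a ≤ (K + 2) * (1 - Real.exp (-s)) := by
  have h : a ≤ (K + 2) * (s / (1 + s)) := by
    rw [← mul_div_assoc, le_div_iff₀ (by linarith)]
    nlinarith
  exact h.trans (mul_le_mul_of_nonneg_left (frac_le hs) (by linarith))

lemma le_weight' {d s : ℝ} (hs : 0 ≤ s) (hd : 0 < d) :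
    s * Real.exp (-(d * s)) ≤ (1 + 1 / d) * (1 - Real.exp (-s)) := by
  have h : s * Real.exp (-(d * s)) ≤ (1 + 1 / d) * (s / (1 + s)) := by
    rw [← mul_div_assoc, le_div_iff₀ (by linarith)]
    have h1 : Real.exp (-(d * s)) ≤ 1 := Real.exp_le_one_iff.2 (by nlinarith)
    have h2 : s * Real.exp (-(d * s)) ≤ 1 / d := by
      have := Real.add_one_le_exp (d * s)
      rw [Real.exp_neg, ← div_eq_mul_inv, div_le_div_iff₀ (Real.exp_pos _) hd]
      nlinarith
    nlinarith
  exact h.trans (mul_le_mul_of_nonneg_left (frac_le hs) (by positivity))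

variable {n : ℕ}

lemma re_sum (l : Fin n → ℂ) (u : Fin n → ℝ) :
    (∑ j, l j * (u j : ℂ)).re = ∑ j, (l j).re * u j := by
  simp [Complex.re_sum]

lemma norm_sum_le' (l : Fin n → ℂ) (u : Fin n → ℝ) (hu : ∀ j, 0 ≤ u j) {K : ℝ}
    (hl : ∀ j, ‖l j‖ ≤ K) :
    ‖∑ j, l j * (u j : ℂ)‖ ≤ K * ∑ j, u j := by
  rw [Finset.mul_sum]
  refine (norm_sum_le _ _).trans (Finset.sum_le_sum fun j _ => ?_)
  rw [norm_mul, Complex.norm_real, Real.norm_of_nonneg (hu j)]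
  exact mul_le_mul_of_nonneg_right (hl j) (hu j)

lemma exp_bound (l : Fin n → ℂ) (u : Fin n → ℝ) (hu : ∀ j, 0 ≤ u j) {K : ℝ} (hK : 0 ≤ K)
    (hl : ∀ j, ‖l j‖ ≤ K) (hre : ∀ j, (l j).re ≤ 0) :
    ‖Complex.exp (∑ j, l j * (u j : ℂ)) - 1‖ ≤ (K + 2) * (1 - Real.exp (-∑ j, u j)) := by
  have hr : (∑ j, l j * (u j : ℂ)).re ≤ 0 := by
    rw [re_sum]
    exact Finset.sum_nonpos fun j _ => mul_nonpos_of_nonpos_of_nonneg (hre j) (hu j)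
  refine le_weight (Finset.sum_nonneg fun j _ => hu j) hK ?_ (norm_exp_sub_one_le_two hr)
  exact (norm_exp_sub_one_le_of_re hr).trans (norm_sum_le' l u hu hl)

lemma aesm (m : Measure (Fin n → ℝ)) (l : Fin n → ℂ) :
    AEStronglyMeasurable (fun u : Fin n → ℝ => Complex.exp (∑ j, l j * (u j : ℂ)) - 1) m := by
  apply Continuous.aestronglyMeasurable
  fun_prop

/-- the integral part -/
noncomputable def H (m : Measure (Fin n → ℝ)) (l : Fin n → ℂ) : ℂ :=
  ∫ u, (Complex.exp (∑ j, l j * (u j : ℂ)) - 1) ∂m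

lemma integrable_H {m : Measure (Fin n → ℝ)}
    (hm : Integrable (fun u : Fin n → ℝ => 1 - Real.exp (-∑ j, u j)) m)
    (hpos : ∀ᵐ u ∂m, ∀ j, 0 ≤ u j) (l : Fin n → ℂ) (hre : ∀ j, (l j).re ≤ 0) :
    Integrable (fun u : Fin n → ℝ => Complex.exp (∑ j, l j * (u j : ℂ)) - 1) m := by
  refine (hm.const_mul (‖l‖ + 2)).mono' (aesm m l) ?_
  filter_upwards [hpos] with u hu
  exact exp_bound l u hu (norm_nonneg _) (fun j => norm_le_pi_norm l j) hre

lemma tendsto_H {m : Measure (Fin n → ℝ)}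
    (hm : Integrable (fun u : Fin n → ℝ => 1 - Real.exp (-∑ j, u j)) m)
    (hpos : ∀ᵐ u ∂m, ∀ j, 0 ≤ u j) (l : Fin n → ℂ) (lk : ℕ → Fin n → ℂ)
    (hlk : Tendsto lk atTop (𝓝 l)) (hre : ∀ k j, (lk k j).re ≤ 0) :
    Tendsto (fun k => H m (lk k)) atTop (𝓝 (H m l)) := by
  obtain ⟨K, hK⟩ : ∃ K, ∀ k, ‖lk k‖ ≤ K := by
    obtain ⟨K, hK⟩ := (Metric.isBounded_range_of_tendsto lk hlk).exists_norm_le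
    exact ⟨K, fun k => hK _ ⟨k, rfl⟩⟩
  have hK0 : 0 ≤ K := (norm_nonneg _).trans (hK 0)
  refine tendsto_integral_of_dominated_convergence
    (fun u => (K + 2) * (1 - Real.exp (-∑ j, u j))) (fun k => aesm m _) (hm.const_mul _) ?_ ?_
  · intro k
    filter_upwards [hpos] with u hu
    exact exp_bound (lk k) u hu hK0 (fun j => (norm_le_pi_norm _ j).trans (hK k)) (hre k)
  · refine Eventually.of_forall fun u => ?_
    have hc : Continuous fun l : Fin n → ℂ => Complex.exp (∑ j, l j * (u j : ℂ)) - 1 := by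
      fun_prop
    exact (hc.tendsto l).comp hlk

/-- admissible set of parameters -/
def U (a b : Fin n → ℝ) : Set ℂ := {z | ∀ j, a j + z.re * b j < 0}

lemma U_open (a b : Fin n → ℝ) : IsOpen (U a b) := by
  have : U a b = ⋂ j, {z : ℂ | a j + z.re * b j < 0} := by ext; simp [U]
  rw [this]
  refine isOpen_iInter_of_finite fun j => ?_
  exact isOpen_lt (by fun_prop) continuous_const

lemma U_convex (a b : Fin n → ℝ) : Convex ℝ (U a b) := by
  intro z hz w hw p q hp hq hpq j
  have h1 := hz j
  have h2 := hw j
  simp only [Complex.add_re, Complex.real_smul, Complex.re_ofReal_mul]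
  have : a j + (p * z.re + q * w.re) * b j
      = p * (a j + z.re * b j) + q * (a j + w.re * b j) := by
    linear_combination (-(a j)) * hpq
  rw [this]
  rcases hp.eq_or_lt with rfl | hp'
  · have : q = 1 := by linarith
    subst this; linarith
  · nlinarith [mul_pos_of_neg_of_neg h1 (by linarith : -p < 0), mul_nonneg hq (neg_nonneg.2 h2.le)]

noncomputable def line (a b : Fin n → ℝ) (z : ℂ) : Fin n → ℂ := fun j => (a j : ℂ) + z * (b j : ℂ)

lemma line_re (a b : Fin n → ℝ) (z : ℂ) (j : Fin n) : (line a b z j).re = a j + z.re * b j := by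
  simp [line]

lemma diff_H {m : Measure (Fin n → ℝ)}
    (hm : Integrable (fun u : Fin n → ℝ => 1 - Real.exp (-∑ j, u j)) m)
    (hpos : ∀ᵐ u ∂m, ∀ j, 0 ≤ u j) (a b : Fin n → ℝ) :
    DifferentiableOn ℂ (fun z => H m (line a b z)) (U a b) := by
  intro z₀ hz₀
  obtain ⟨d, hd, hd'⟩ : ∃ d > 0, ∀ j, a j + z₀.re * b j < -d := by
    have : ∀ᶠ d in 𝓝[>] (0 : ℝ), ∀ j, a j + z₀.re * b j < -d := by
      rw [eventually_all]
      intro j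
      have : Tendsto (fun d : ℝ => -d) (𝓝[>] 0) (𝓝 0) := by
        have : Tendsto (fun d : ℝ => -d) (𝓝 0) (𝓝 (-0)) := (continuous_neg).tendsto 0
        rw [neg_zero] at this
        exact this.mono_left nhdsWithin_le_nhds
      exact this.eventually (lt_mem_nhds (hz₀ j))
    obtain ⟨d, h1, h2⟩ := (this.and self_mem_nhdsWithin).exists
    exact ⟨d, h2, h1⟩
  set s : Set ℂ := U (fun j => a j + d) b with hs
  have hsn : s ∈ 𝓝 z₀ := (U_open _ _).mem_nhds (fun j => by have := hd' j; show a j + d + z₀.re * b j < 0; linarith)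
  refine ((hasDerivAt_integral_of_dominated_loc_of_deriv_le (𝕜 := ℂ) (μ := m) (s := s) (x₀ := z₀)
    (F := fun z u => Complex.exp (∑ j, line a b z j * (u j : ℂ)) - 1)
    (F' := fun z u => Complex.exp (∑ j, line a b z j * (u j : ℂ)) * (∑ j, (b j : ℂ) * (u j : ℂ)))
    (bound := fun u => ‖b‖ * ((1 + 1 / d) * (1 - Real.exp (-∑ j, u j))))
    hsn (Eventually.of_forall fun z => aesm m _)
    (integrable_H hm hpos _ fun j => by rw [line_re]; exact (hz₀ j).le) ?_ ?_
    ((hm.const_mul _).const_mul _) ?_).2).differentiableAt.differentiableWithinAt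
  · apply Continuous.aestronglyMeasurable
    fun_prop
  · filter_upwards [hpos] with u hu z hz
    have hS : 0 ≤ ∑ j, u j := Finset.sum_nonneg fun j _ => hu j
    have h1 : ‖∑ j, (b j : ℂ) * (u j : ℂ)‖ ≤ ‖b‖ * ∑ j, u j :=
      norm_sum_le' (fun j => (b j : ℂ)) u hu
        (fun j => by rw [Complex.norm_real]; exact norm_le_pi_norm b j)
    have h2 : ‖Complex.exp (∑ j, line a b z j * (u j : ℂ))‖ ≤ Real.exp (-(d * ∑ j, u j)) := by
      rw [Complex.norm_exp, re_sum]
      apply Real.exp_le_exp.2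
      rw [Finset.mul_sum, ← Finset.sum_neg_distrib]
      refine Finset.sum_le_sum fun j _ => ?_
      rw [line_re]
      have := hz j
      simp only at this
      nlinarith [hu j]
    rw [norm_mul]
    calc _ ≤ Real.exp (-(d * ∑ j, u j)) * (‖b‖ * ∑ j, u j) := by gcongr
      _ = ‖b‖ * ((∑ j, u j) * Real.exp (-(d * ∑ j, u j))) := by ring
      _ ≤ _ := mul_le_mul_of_nonneg_left (le_weight' hS hd) (norm_nonneg _)
  · refine Eventually.of_forall fun u z _ => ?_
    have h : HasDerivAt (fun z => ∑ j, line a b z j * (u j : ℂ))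
        (∑ j, (b j : ℂ) * (u j : ℂ)) z := by
      refine HasDerivAt.fun_sum fun j _ => ?_
      have := (((hasDerivAt_id z).mul_const (b j : ℂ)).const_add (a j : ℂ)).mul_const (u j : ℂ)
      simpa [line] using this
    exact h.cexp.sub_const 1

/-- Complex form of the subordination identity. -/
lemma subord {ψ : (Fin n → ℝ) → ℝ} {c₀ : ℝ} {c₁ : Fin n → ℝ} {μ : Measure (Fin n → ℝ)}
    (hrep : HasLevyRep n ψ c₀ c₁ μ) {ν : ℝ → Measure (Fin n → ℝ)} (hν : IsSubordinator n ψ ν)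
    {t : ℝ} (ht : 0 ≤ t) (l : Fin n → ℂ) (hl : ∀ j, (l j).re ≤ 0) :
    ∫ u, Complex.exp (∑ j, l j * (u j : ℂ)) ∂(ν t) = Complex.exp (t * psiC n c₀ c₁ μ l) := by
  obtain ⟨hc0, hc1, hμ0, hμi, hμψ⟩ := hrep
  obtain ⟨hfin, hν0, hνψ⟩ := hν t ht
  have hμpos : ∀ᵐ u ∂μ, ∀ j, 0 ≤ u j := by
    have : ∀ᵐ u ∂μ, ((∀ j, 0 ≤ u j) ∧ u ≠ 0) := hμ0
    exact this.mono fun u h => h.1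
  have hνpos : ∀ᵐ u ∂(ν t), ∀ j, 0 ≤ u j := hν0
  have hμm : Integrable (fun u : Fin n → ℝ => 1 - Real.exp (-∑ j, u j)) μ := by
    have := (hμi (fun _ => -1) (fun j => by norm_num)).neg
    refine this.congr (Eventually.of_forall fun u => ?_)
    simp
  have hνm : Integrable (fun u : Fin n → ℝ => 1 - Real.exp (-∑ j, u j)) (ν t) := by
    refine (integrable_const (1 : ℝ)).mono' ?_ ?_
    · apply Continuous.aestronglyMeasurable; fun_prop
    · filter_upwards [hνpos] with u hu
      have hS : 0 ≤ ∑ j, u j := Finset.sum_nonneg fun j _ => hu j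
      have h1 := Real.exp_pos (-∑ j, u j)
      have h2 : Real.exp (-∑ j, u j) ≤ 1 := Real.exp_le_one_iff.2 (by linarith)
      rw [Real.norm_eq_abs, abs_le]; constructor <;> linarith
  have hsplit : ∀ l : Fin n → ℂ, (∀ j, (l j).re ≤ 0) →
      ∫ u, Complex.exp (∑ j, l j * (u j : ℂ)) ∂(ν t) = H (ν t) l + ((ν t).real Set.univ : ℂ) := by
    intro l hl
    have h1 := integrable_H hνm hνpos l hl
    have : ∫ u, Complex.exp (∑ j, l j * (u j : ℂ)) ∂(ν t)
        = ∫ u, ((Complex.exp (∑ j, l j * (u j : ℂ)) - 1) + 1) ∂(ν t) := by simp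
    rw [this, integral_add h1 (integrable_const _)]
    simp [H]
  have hpsi : ∀ l, psiC n c₀ c₁ μ l = (c₀ : ℂ) + ∑ j, (c₁ j : ℂ) * l j + H μ l := fun l => rfl
  -- the real case
  have hreal : ∀ s ∈ negOrthant n, H (ν t) (fun j => (s j : ℂ)) + ((ν t).real Set.univ : ℂ)
      = Complex.exp (t * psiC n c₀ c₁ μ (fun j => (s j : ℂ))) := by
    intro s hs
    rw [← hsplit _ (fun j => by simpa using (hs j).le)]
    have h1 : psiC n c₀ c₁ μ (fun j => (s j : ℂ)) = (ψ s : ℂ) := by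
      rw [hμψ s hs, psiC]
      push_cast
      rw [← integral_complex_ofReal]
      simp
    rw [h1, ← Complex.ofReal_mul, ← Complex.ofReal_exp, ← hνψ s hs, ← integral_complex_ofReal]
    simp
  -- the open case
  have hopen : ∀ l : Fin n → ℂ, (∀ j, (l j).re < 0) → H (ν t) l + ((ν t).real Set.univ : ℂ)
      = Complex.exp (t * psiC n c₀ c₁ μ l) := by
    intro l hl
    set a : Fin n → ℝ := fun j => (l j).re
    set b : Fin n → ℝ := fun j => (l j).im
    have hF : DifferentiableOn ℂ (fun z => H (ν t) (line a b z) + ((ν t).real Set.univ : ℂ))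
        (U a b) := (diff_H hνm hνpos a b).add_const _
    have hG : DifferentiableOn ℂ (fun z => Complex.exp (t * psiC n c₀ c₁ μ (line a b z)))
        (U a b) := by
      simp only [hpsi]
      refine DifferentiableOn.cexp (DifferentiableOn.const_mul ?_ _)
      refine DifferentiableOn.add ?_ (diff_H hμm hμpos a b)
      unfold line
      fun_prop
    have h0 : (0 : ℂ) ∈ U a b := fun j => by simpa [a] using hl j
    have hI : Complex.I ∈ U a b := fun j => by simpa [a] using hl j
    have hfreq : ∃ᶠ z in 𝓝[≠] (0 : ℂ), H (ν t) (line a b z) + ((ν t).real Set.univ : ℂ)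
        = Complex.exp (t * psiC n c₀ c₁ μ (line a b z)) := by
      have hT : Tendsto (fun x : ℝ => (x : ℂ)) (𝓝[≠] 0) (𝓝[≠] 0) := by
        refine tendsto_nhdsWithin_iff.2 ⟨?_, ?_⟩
        · have := Complex.continuous_ofReal.tendsto 0
          rw [Complex.ofReal_zero] at this
          exact this.mono_left nhdsWithin_le_nhds
        · filter_upwards [self_mem_nhdsWithin] with x hx
          simpa using hx
      refine hT.frequently (Eventually.frequently ?_)
      have hU : ∀ᶠ x : ℝ in 𝓝[≠] 0, (x : ℂ) ∈ U a b :=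
        hT.eventually (mem_nhdsWithin_of_mem_nhds ((U_open a b).mem_nhds h0))
      filter_upwards [hU] with x hx
      have := hreal (fun j => a j + x * b j) (fun j => by simpa using hx j)
      have e : (fun j => ((a j + x * b j : ℝ) : ℂ)) = line a b x := by
        ext j; simp [line]
      rw [e] at this
      exact this
    have := (hF.analyticOnNhd (U_open a b)).eqOn_of_preconnected_of_frequently_eq
      (hG.analyticOnNhd (U_open a b)) (U_convex a b).isPreconnected h0 hfreq hI
    have e : line a b Complex.I = l := by
      ext j
      simp only [line, a, b]
      rw [mul_comm]
      exact Complex.re_add_im (l j)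
    simpa only [e] using this
  rw [hsplit l hl]
  -- boundary
  set lk : ℕ → Fin n → ℂ := fun k j => l j - ((1 / ((k : ℝ) + 1) : ℝ) : ℂ) with hlk
  have hlkre : ∀ k j, (lk k j).re < 0 := by
    intro k j
    have : (0 : ℝ) < 1 / ((k : ℝ) + 1) := by positivity
    have h := hl j
    simp only [hlk, Complex.sub_re, Complex.ofReal_re]
    linarith
  have hlkt : Tendsto lk atTop (𝓝 l) := by
    rw [tendsto_pi_nhds]
    intro j
    have h1 : Tendsto (fun k : ℕ => ((1 / ((k : ℝ) + 1) : ℝ) : ℂ)) atTop (𝓝 ((0 : ℝ) : ℂ)) :=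
      (Complex.continuous_ofReal.tendsto 0).comp tendsto_one_div_add_atTop_nhds_zero_nat
    have h2 := (tendsto_const_nhds (x := l j)).sub h1
    rw [Complex.ofReal_zero, sub_zero] at h2
    exact h2
  have hL := (tendsto_H hνm hνpos l lk hlkt fun k j => (hlkre k j).le).add_const
    ((ν t).real Set.univ : ℂ)
  have hR : Tendsto (fun k => Complex.exp (t * psiC n c₀ c₁ μ (lk k))) atTop
      (𝓝 (Complex.exp (t * psiC n c₀ c₁ μ l))) := by
    refine (Complex.continuous_exp.tendsto _).comp (Tendsto.const_mul _ ?_)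
    simp only [hpsi]
    refine Tendsto.add ?_ (tendsto_H hμm hμpos l lk hlkt fun k j => (hlkre k j).le)
    have hc : Continuous fun l : Fin n → ℂ => (c₀ : ℂ) + ∑ j, (c₁ j : ℂ) * l j := by fun_prop
    exact (hc.tendsto l).comp hlkt
  refine tendsto_nhds_unique hL (hR.congr fun k => ?_)
  exact (hopen _ (hlkre k)).symm

end JS

namespace JS

variable {X : Type*} [NormedAddCommGroup X] [NormedSpace ℂ X]

lemma sg_diff {T : ℝ → X →L[ℂ] X} (h : IsC0Semigroup T) {a b : ℝ} (ha : 0 ≤ a) (hab : a ≤ b)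
    (x : X) : T b x - T a x = T a (T (b - a) x - x) := by
  have := h.2.1 a (b - a) ha (by linarith)
  rw [add_sub_cancel] at this
  rw [this, map_sub]; rfl

lemma sg_cont {T : ℝ → X →L[ℂ] X} (h : IsC0Semigroup T) {M : ℝ}
    (hM : ∀ t, 0 ≤ t → ‖T t‖ ≤ M) :
    Continuous (fun p : ℝ × X => T (max p.1 0) p.2) := by
  have hM0 : 0 ≤ M := (norm_nonneg _).trans (hM 0 le_rfl)
  rw [continuous_iff_continuousAt]
  rintro ⟨s, x⟩
  have key : ∀ a b : ℝ, 0 ≤ a → 0 ≤ b → ‖T b x - T a x‖ ≤ M * ‖T |b - a| x - x‖ := by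
    intro a b ha hb
    rcases le_total a b with hab | hab
    · rw [sg_diff h ha hab, abs_of_nonneg (by linarith)]
      exact (T a).le_of_opNorm_le (hM a ha) _
    · rw [norm_sub_rev, sg_diff h hb hab, abs_of_nonpos (by linarith), neg_sub]
      exact (T b).le_of_opNorm_le (hM b hb) _
  rw [ContinuousAt, tendsto_iff_norm_sub_tendsto_zero]
  have hr : Tendsto (fun p : ℝ × X => |max p.1 0 - max s 0|) (𝓝 (s, x)) (𝓝[≥] 0) := by
    refine tendsto_nhdsWithin_iff.2 ⟨?_, Eventually.of_forall fun p => Set.mem_Ici.2 (abs_nonneg _)⟩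
    have : Continuous (fun p : ℝ × X => |max p.1 0 - max s 0|) := by fun_prop
    simpa using this.tendsto (s, x)
  have h1 : Tendsto (fun p : ℝ × X => M * ‖T |max p.1 0 - max s 0| x - x‖) (𝓝 (s, x)) (𝓝 0) := by
    have := (((h.2.2 x).comp hr).sub_const x).norm.const_mul M
    simpa using this
  have h2 : Tendsto (fun p : ℝ × X => M * ‖p.2 - x‖) (𝓝 (s, x)) (𝓝 0) := by
    have : Continuous (fun p : ℝ × X => M * ‖p.2 - x‖) := by fun_prop
    simpa using this.tendsto (s, x)
  have h3 := h2.add h1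
  rw [add_zero] at h3
  refine squeeze_zero (fun _ => norm_nonneg _) (fun p => ?_) h3
  have e : T (max p.1 0) p.2 - T (max s 0) x
      = T (max p.1 0) (p.2 - x) + (T (max p.1 0) x - T (max s 0) x) := by
    rw [map_sub]; abel
  simp only
  rw [e]
  refine (norm_add_le _ _).trans (add_le_add ?_ (key _ _ (le_max_right _ _) (le_max_right _ _)))
  exact (T (max p.1 0)).le_of_opNorm_le (hM _ (le_max_right _ _)) _

lemma sg_cont1 {T : ℝ → X →L[ℂ] X} (h : IsC0Semigroup T) {M : ℝ}
    (hM : ∀ t, 0 ≤ t → ‖T t‖ ≤ M) (x : X) : Continuous (fun t : ℝ => T (max t 0) x) :=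
  (sg_cont h hM).comp (by fun_prop : Continuous fun t : ℝ => (t, x))

lemma sg_deriv {T : ℝ → X →L[ℂ] X} (h : IsC0Semigroup T) {x y : X} (hxy : InGenDomain T x y)
    {s : ℝ} (hs : 0 ≤ s) :
    HasDerivWithinAt (fun r : ℝ => T (max r 0) x) (T s y) (Set.Ici s) s := by
  rw [← hasDerivWithinAt_Ioi_iff_Ici, hasDerivWithinAt_iff_tendsto_slope' (by simp)]
  have hr : Tendsto (fun r : ℝ => r - s) (𝓝[>] s) (𝓝[>] 0) := by
    refine tendsto_nhdsWithin_iff.2 ⟨?_, ?_⟩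
    · have : Continuous (fun r : ℝ => r - s) := by fun_prop
      have := this.tendsto s
      rw [sub_self] at this
      exact this.mono_left nhdsWithin_le_nhds
    · filter_upwards [self_mem_nhdsWithin] with r hr
      exact sub_pos.2 (Set.mem_Ioi.1 hr)
  have := ((T s).continuous.tendsto y).comp (hxy.comp hr)
  refine this.congr' ?_
  filter_upwards [self_mem_nhdsWithin] with r hr
  have hr' : s < r := hr
  simp only [Function.comp, slope, vsub_eq_sub]
  rw [max_eq_left hs, max_eq_left (hs.trans hr'.le), sg_diff h hs hr'.le,
    (T s).map_smul_of_tower]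

lemma sg_approx {T : ℝ → X →L[ℂ] X} (h : IsC0Semigroup T) {M : ℝ}
    (hM : ∀ t, 0 ≤ t → ‖T t‖ ≤ M) {x y : X} (hxy : InGenDomain T x y) (l : ℂ) {t : ℝ}
    (ht : 0 ≤ t) :
    ‖Complex.exp (-(l * t)) • T t x - x‖ ≤ Real.exp (‖l‖ * t) * M * ‖y - l • x‖ * t := by
  have hM0 : 0 ≤ M := (norm_nonneg _).trans (hM 0 le_rfl)
  have hc : Continuous (fun s : ℝ => Complex.exp (-(l * s)) • T (max s 0) x) :=
    (by fun_prop : Continuous fun s : ℝ => Complex.exp (-(l * s))).smul (sg_cont1 h hM x)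
  have := norm_image_sub_le_of_norm_deriv_right_le_segment (a := 0) (b := t)
    (f := fun s : ℝ => Complex.exp (-(l * s)) • T (max s 0) x)
    (f' := fun s : ℝ => Complex.exp (-(l * s)) • T s (y - l • x))
    (C := Real.exp (‖l‖ * t) * M * ‖y - l • x‖) hc.continuousOn ?_ ?_ t ⟨ht, le_rfl⟩
  · simpa [ht, h.1] using this
  · intro s hs
    have h1 : HasDerivAt (fun s : ℝ => Complex.exp (-(l * s))) (Complex.exp (-(l * s)) * (-l)) s := by
      have h0 : HasDerivAt (fun s : ℝ => -(l * (s : ℂ))) (-l) s := by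
        simpa using ((Complex.ofRealCLM.hasDerivAt (x := s)).const_mul l).fun_neg
      exact h0.cexp
    have h2 := h1.hasDerivWithinAt (s := Set.Ici s) |>.fun_smul (sg_deriv h hxy hs.1)
    convert h2 using 1
    rw [max_eq_left hs.1, map_sub, map_smul, smul_sub, smul_smul, mul_neg, neg_smul]
    abel
  · intro s hs
    rw [norm_smul, mul_assoc]
    refine mul_le_mul ?_ ((T s).le_of_opNorm_le (hM s hs.1) _) (norm_nonneg _) (Real.exp_pos _).le
    rw [Complex.norm_exp]
    apply Real.exp_le_exp.2
    refine (Complex.re_le_norm _).trans ?_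
    rw [norm_neg, norm_mul, Complex.norm_real, Real.norm_of_nonneg hs.1]
    exact mul_le_mul_of_nonneg_left hs.2.le (norm_nonneg _)

lemma exp_neg_smul (w : ℂ) (a b : X) :
    a - Complex.exp w • b = Complex.exp w • (Complex.exp (-w) • a - b) := by
  rw [smul_sub, smul_smul, ← Complex.exp_add]; simp

lemma exp_neg_smul' (w : ℂ) (a b : X) :
    Complex.exp (-w) • a - b = Complex.exp (-w) • (a - Complex.exp w • b) := by
  rw [smul_sub, smul_smul, ← Complex.exp_add]; simp

lemma sg_approx_tendsto {T : ℝ → X →L[ℂ] X} (h : IsC0Semigroup T) {M : ℝ}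
    (hM : ∀ t, 0 ≤ t → ‖T t‖ ≤ M) {x y : ℕ → X} (hxy : ∀ m, InGenDomain T (x m) (y m)) (l : ℂ)
    (hl : Tendsto (fun m => ‖y m - l • x m‖) atTop (𝓝 0)) {t : ℝ} (ht : 0 ≤ t) :
    Tendsto (fun m => T t (x m) - Complex.exp (l * t) • x m) atTop (𝓝 0) := by
  simp only [exp_neg_smul]
  have : Tendsto (fun m => Complex.exp (-(l * t)) • T t (x m) - x m) atTop (𝓝 0) := by
    refine squeeze_zero_norm (fun m => sg_approx h hM (hxy m) l ht) ?_
    simpa using (hl.const_mul (Real.exp (‖l‖ * t) * M)).mul_const t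
  simpa using this.const_smul (Complex.exp (l * t))

lemma re_nonpos_of_bdd {r C : ℝ} (h : ∀ t : ℝ, 0 ≤ t → Real.exp (r * t) ≤ C) : r ≤ 0 := by
  by_contra! hr
  have hC : 0 < C := (Real.exp_pos _).trans_le (h 0 le_rfl)
  have h1 := h (C / r) (by positivity)
  rw [mul_div_cancel₀ _ hr.ne'] at h1
  linarith [Real.add_one_le_exp C]

section
variable [CompleteSpace X]

lemma gen_integral {g : ℝ → X →L[ℂ] X} (h : IsC0Semigroup g)
    (hc : ∀ x, Continuous fun t : ℝ => g (max t 0) x) (α : ℂ) {b : ℝ} (hb : 0 ≤ b) (x : X) :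
    InGenDomain g (∫ s in (0 : ℝ)..b, Complex.exp (-(α * s)) • g (max s 0) x)
      (Complex.exp (-(α * b)) • g b x - x
        + α • ∫ s in (0 : ℝ)..b, Complex.exp (-(α * s)) • g (max s 0) x) := by
  set k : ℝ → X := fun s => Complex.exp (-(α * s)) • g (max s 0) x with hk
  have hkc : Continuous k :=
    (by fun_prop : Continuous fun s : ℝ => Complex.exp (-(α * s))).smul (hc x)
  set K : ℝ → X := fun t => ∫ s in (0 : ℝ)..t, k s with hK
  have hKd : ∀ t, HasDerivAt K (k t) t := fun t => hkc.integral_hasStrictDerivAt 0 t |>.hasDerivAt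
  have hgz : ∀ t : ℝ, 0 ≤ t → g t (K b) = Complex.exp (α * t) • (K (t + b) - K t) := by
    intro t ht
    have h1 : g t (K b) = ∫ s in (0 : ℝ)..b, g t (k s) :=
      ((g t).intervalIntegral_comp_comm (hkc.intervalIntegrable 0 b)).symm
    have h2 : ∫ s in (0 : ℝ)..b, g t (k s)
        = ∫ s in (0 : ℝ)..b, Complex.exp (α * t) • k (s + t) := by
      refine intervalIntegral.integral_congr fun s hs => ?_
      rw [Set.uIcc_of_le hb] at hs
      have h3 := h.2.1 t s ht hs.1
      simp only [hk]
      rw [max_eq_left hs.1, max_eq_left (add_nonneg hs.1 ht), map_smul, smul_smul,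
        ← Complex.exp_add, add_comm s t, h3]
      congr 2
      push_cast; ring
    rw [h1, h2, intervalIntegral.integral_smul, intervalIntegral.integral_comp_add_right,
      zero_add, add_comm b t]
    congr 1
    rw [hK]
    simp only
    rw [intervalIntegral.integral_interval_sub_left (hkc.intervalIntegrable _ _)
      (hkc.intervalIntegrable _ _)]
  have hd : HasDerivAt (fun t : ℝ => Complex.exp (α * t) • (K (t + b) - K t))
      (k b - k 0 + α • K b) 0 := by
    have h0 : HasDerivAt (fun s : ℝ => (α * (s : ℂ))) α 0 := by
      simpa using ((Complex.ofRealCLM.hasDerivAt (x := (0 : ℝ))).const_mul α)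
    have h1 := h0.cexp
    have h2 : HasDerivAt (fun t => K (t + b)) (k b) 0 := by
      have := hKd (0 + b)
      have := HasDerivAt.comp_add_const 0 b this
      simpa using this
    have h3 := h1.fun_smul (h2.fun_sub (hKd 0))
    have hK0 : K 0 = 0 := by simp [hK]
    simpa [hK0] using h3
  have := hd.tendsto_slope_zero_right
  have hk0 : k 0 = x := by simp [hk, h.1]
  have hkb : k b = Complex.exp (-(α * b)) • g b x := by simp [hk, max_eq_left hb]
  rw [hk0, hkb] at this
  refine this.congr' ?_
  filter_upwards [self_mem_nhdsWithin] with t ht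
  rw [zero_add, ← hgz t (le_of_lt ht)]
  congr 2
  simp [hK]

lemma sg_residual {T : ℝ → X →L[ℂ] X} (h : IsC0Semigroup T) {M : ℝ}
    (hM : ∀ t, 0 ≤ t → ‖T t‖ ≤ M) (l : ℂ) (f : X →L[ℂ] ℂ)
    (hf : ∀ x y, InGenDomain T x y → f (l • x - y) = 0) {t : ℝ} (ht : 0 ≤ t) (x : X) :
    f (T t x) = Complex.exp (l * t) * f x := by
  have := hf _ _ (gen_integral h (sg_cont1 h hM) l ht x)
  rw [sub_add_cancel_right, map_neg, neg_eq_zero, map_sub, map_smul, sub_eq_zero,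
    smul_eq_mul] at this
  rw [← this, ← mul_assoc, ← Complex.exp_add]
  simp

end

/-! products -/

lemma Tprod_succ {n : ℕ} (T : Fin (n + 1) → ℝ → X →L[ℂ] X) (u : Fin (n + 1) → ℝ) (x : X) :
    Tprod T u x = T 0 (u 0) (Tprod (fun j => T j.succ) (fun j => u j.succ) x) := by
  simp [Tprod, List.ofFn_succ]

lemma Tprod_zero (T : Fin 0 → ℝ → X →L[ℂ] X) (u : Fin 0 → ℝ) (x : X) :
    Tprod T u x = x := by
  simp [Tprod]

lemma Tprod_bound {n : ℕ} (T : Fin n → ℝ → X →L[ℂ] X) (M : Fin n → ℝ) (u : Fin n → ℝ)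
    (hM : ∀ j, ‖T j (u j)‖ ≤ M j) (x : X) : ‖Tprod T u x‖ ≤ (∏ j, M j) * ‖x‖ := by
  induction n with
  | zero => simp [Tprod_zero]
  | succ n ih =>
    rw [Tprod_succ, Fin.prod_univ_succ, mul_assoc]
    refine ((T 0 (u 0)).le_of_opNorm_le (hM 0) _).trans ?_
    exact mul_le_mul_of_nonneg_left (ih _ _ _ fun j => hM j.succ) ((norm_nonneg _).trans (hM 0))

lemma Tprod_tendsto {n : ℕ} (T : Fin n → ℝ → X →L[ℂ] X) (u : Fin n → ℝ) (c : Fin n → ℂ)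
    (x : ℕ → X) (h : ∀ j, Tendsto (fun m => T j (u j) (x m) - c j • x m) atTop (𝓝 0)) :
    Tendsto (fun m => Tprod T u (x m) - (∏ j, c j) • x m) atTop (𝓝 0) := by
  induction n with
  | zero => simp [Tprod_zero]
  | succ n ih =>
    have h1 := ih (fun j => T j.succ) (fun j => u j.succ) (fun j => c j.succ) fun j => h j.succ
    have h2 := ((T 0 (u 0)).continuous.tendsto 0).comp h1
    have h3 := h2.add ((h 0).const_smul (∏ j : Fin n, c j.succ))
    simp only [map_zero, smul_zero, add_zero] at h3
    refine h3.congr fun m => ?_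
    simp only [Function.comp]
    rw [Tprod_succ, Fin.prod_univ_succ, map_sub, map_smul, smul_sub, smul_smul,
      mul_comm (c 0)]
    abel

lemma Tprod_dual {n : ℕ} (T : Fin n → ℝ → X →L[ℂ] X) (u : Fin n → ℝ) (c : Fin n → ℂ)
    (f : X →L[ℂ] ℂ) (h : ∀ j x, f (T j (u j) x) = c j * f x) (x : X) :
    f (Tprod T u x) = (∏ j, c j) * f x := by
  induction n with
  | zero => simp [Tprod_zero]
  | succ n ih =>
    rw [Tprod_succ, Fin.prod_univ_succ, h, ih _ _ (fun j => c j.succ) fun j => h j.succ, mul_assoc]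

lemma Tprod_cont {n : ℕ} (T : Fin n → ℝ → X →L[ℂ] X)
    (h : ∀ j, Continuous (fun p : ℝ × X => T j (max p.1 0) p.2)) (x : X) :
    Continuous (fun u : Fin n → ℝ => Tprod (fun j t => T j (max t 0)) u x) := by
  induction n with
  | zero => simp only [Tprod_zero]; exact continuous_const
  | succ n ih =>
    simp only [Tprod_succ]
    have h1 := (ih (fun j => T j.succ) fun j => h j.succ).comp
      (by fun_prop : Continuous fun u : Fin (n + 1) → ℝ => fun j : Fin n => u j.succ)
    exact (h 0).comp ((continuous_apply (0 : Fin (n + 1))).prodMk h1)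

lemma Tprod_max {n : ℕ} (T : Fin n → ℝ → X →L[ℂ] X) (u : Fin n → ℝ) (hu : ∀ j, 0 ≤ u j) :
    Tprod (fun j t => T j (max t 0)) u = Tprod T u := by
  simp [Tprod, hu]

lemma exists_dual {p : Submodule ℂ X} (hp : ¬ Dense (p : Set X)) :
    ∃ f : X →L[ℂ] ℂ, f ≠ 0 ∧ ∀ a ∈ p, f a = 0 := by
  have : ∃ x, x ∉ p.topologicalClosure := by
    by_contra! hx
    exact hp fun x => hx x
  obtain ⟨x, hx⟩ := this
  obtain ⟨f, u, h1, h2⟩ := RCLike.geometric_hahn_banach_closed_point (𝕜 := ℂ) (E := X)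
    (s := (p.topologicalClosure : Set X)) (x := x)
    ((p.topologicalClosure.restrictScalars ℝ).convex)
    p.isClosed_topologicalClosure hx
  have hu : 0 < u := by simpa using h1 0 (Submodule.zero_mem _)
  refine ⟨f, ?_, ?_⟩
  · rintro rfl
    simp at h2
    linarith
  · intro a ha
    by_contra hfa
    have h3 := h1 (((u : ℂ) / f a) • a)
      (Submodule.smul_mem _ _ (p.le_topologicalClosure ha))
    rw [map_smul, smul_eq_mul, div_mul_cancel₀ _ hfa] at h3
    simp at h3

end JS

namespace JS

variable {X : Type*} [NormedAddCommGroup X] [NormedSpace ℂ X] [CompleteSpace X] {n : ℕ}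

lemma Tprod_aesm {T : Fin n → ℝ → X →L[ℂ] X} {M : Fin n → ℝ}
    (hT : ∀ j, IsC0Semigroup (T j)) (hM : ∀ j t, 0 ≤ t → ‖T j t‖ ≤ M j)
    {m : Measure (Fin n → ℝ)} (hpos : ∀ᵐ u ∂m, ∀ j, 0 ≤ u j) (x : X) :
    AEStronglyMeasurable (fun u => Tprod T u x) m := by
  refine (Tprod_cont T (fun j => sg_cont (hT j) (hM j)) x).aestronglyMeasurable.congr ?_
  filter_upwards [hpos] with u hu
  rw [Tprod_max T u hu]

lemma Tprod_integrable {T : Fin n → ℝ → X →L[ℂ] X} {M : Fin n → ℝ}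
    (hT : ∀ j, IsC0Semigroup (T j)) (hM : ∀ j t, 0 ≤ t → ‖T j t‖ ≤ M j)
    {m : Measure (Fin n → ℝ)} [IsFiniteMeasure m] (hpos : ∀ᵐ u ∂m, ∀ j, 0 ≤ u j) (x : X) :
    Integrable (fun u => Tprod T u x) m := by
  refine (integrable_const ((∏ j, M j) * ‖x‖)).mono' (Tprod_aesm hT hM hpos x) ?_
  filter_upwards [hpos] with u hu
  exact Tprod_bound T M u (fun j => hM j _ (hu j)) x

lemma exp_integrable {m : Measure (Fin n → ℝ)} [IsFiniteMeasure m]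
    (hpos : ∀ᵐ u ∂m, ∀ j, 0 ≤ u j) (l : Fin n → ℂ) (hl : ∀ j, (l j).re ≤ 0) :
    Integrable (fun u : Fin n → ℝ => Complex.exp (∑ j, l j * (u j : ℂ))) m := by
  refine (integrable_const (1 : ℝ)).mono' ?_ ?_
  · apply Continuous.aestronglyMeasurable; fun_prop
  · filter_upwards [hpos] with u hu
    rw [Complex.norm_exp, re_sum]
    exact Real.exp_le_one_iff.2
      (Finset.sum_nonpos fun j _ => mul_nonpos_of_nonpos_of_nonneg (hl j) (hu j))

end JS

/-- Assume either that `σ_a(Aⱼ) ⊆ {Re z < 0}` for all `j`, or that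
the limit of `∂ψ/∂sⱼ` at the origin is finite for all `j`. Then
`σ(ψ(A)) ⊇ ψ(σ_J(A))`, where `σ_J(A) = σ_a(A) ∪ σ_R(A)` is the joint spectrum of `A`
and `σ(ψ(A))` is the spectrum (complement of the resolvent set) of `ψ(A)`. -/
theorem image_jointSpectrum_subset_spectrum
    {X : Type*} [NormedAddCommGroup X] [NormedSpace ℂ X] [CompleteSpace X]
    {n : ℕ} (T : Fin n → ℝ → X →L[ℂ] X) (M : Fin n → ℝ)
    (hT : ∀ j, IsC0Semigroup (T j)) (hM : ∀ j t, 0 ≤ t → ‖T j t‖ ≤ M j)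
    (hcomm : ∀ i j s t, 0 ≤ s → 0 ≤ t → T i s ∘L T j t = T j t ∘L T i s)
    (ψ : (Fin n → ℝ) → ℝ) (c₀ : ℝ) (c₁ : Fin n → ℝ) (μ : MeasureTheory.Measure (Fin n → ℝ))
    (hψ : MemTn n ψ) (hrep : HasLevyRep n ψ c₀ c₁ μ)
    (ν : ℝ → MeasureTheory.Measure (Fin n → ℝ)) (hν : IsSubordinator n ψ ν)
    (g : ℝ → X →L[ℂ] X) (hgsem : IsC0Semigroup g)
    (hg : ∀ t, 0 ≤ t → ∀ x : X, g t x = ∫ u, Tprod T u x ∂(ν t))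
    (halt : (∀ j, ∀ z ∈ ApproxSpec (fun x y : X => InGenDomain (T j) x y), z.re < 0) ∨
      (∀ j, ∃ L : ℝ, Tendsto
        (fun s => fderivWithin ℝ ψ (negOrthant n) s (Pi.single j 1))
        (𝓝[negOrthant n] 0) (𝓝 L))) :
    psiC n c₀ c₁ μ '' (JointApproxSpectrum T ∪ JointResidualSpectrum T)
      ⊆ (ResolventSet (fun x y : X => InGenDomain g x y))ᶜ := by
  classical
  rintro α ⟨l, hl, rfl⟩ ⟨Rv, hRv1, hRv2⟩
  set α : ℂ := psiC n c₀ c₁ μ l with hα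
  have hνpos : ∀ t, 0 ≤ t → ∀ᵐ u ∂(ν t), ∀ j, 0 ≤ u j := fun t ht => (hν t ht).2.1
  have hM0 : ∀ j, 0 ≤ M j := fun j => (norm_nonneg _).trans (hM j 0 le_rfl)
  set C : ℝ := ∏ j, M j with hC
  have hC0 : 0 ≤ C := Finset.prod_nonneg fun j _ => hM0 j
  have hmass : ∀ t, 0 ≤ t → (ν t).real Set.univ ≤ 1 := by
    intro t ht
    have h := JS.subord hrep hν ht 0 (fun j => by simp)
    have h0 : psiC n c₀ c₁ μ 0 = (c₀ : ℂ) := by simp [psiC]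
    have h1 : ∫ u : Fin n → ℝ, Complex.exp (∑ j, (0 : Fin n → ℂ) j * (u j : ℂ)) ∂(ν t)
        = (((ν t).real Set.univ : ℝ) : ℂ) := by simp
    rw [h0, h1, ← Complex.ofReal_mul, ← Complex.ofReal_exp] at h
    have h2 := Complex.ofReal_injective h
    rw [h2]
    exact Real.exp_le_one_iff.2 (mul_nonpos_of_nonneg_of_nonpos ht hrep.1)
  have hgM : ∀ t, 0 ≤ t → ‖g t‖ ≤ C := by
    intro t ht
    haveI := (hν t ht).1
    refine ContinuousLinearMap.opNorm_le_bound _ hC0 fun x => ?_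
    rw [hg t ht x]
    refine (norm_integral_le_of_norm_le_const (C := C * ‖x‖) ?_).trans ?_
    · filter_upwards [hνpos t ht] with u hu
      exact JS.Tprod_bound T M u (fun j => hM j _ (hu j)) x
    · exact mul_le_of_le_one_right (by positivity) (hmass t ht)
  have hprod : ∀ u : Fin n → ℝ, ∏ j, Complex.exp (l j * (u j : ℂ))
      = Complex.exp (∑ j, l j * (u j : ℂ)) := fun u => (Complex.exp_sum _ _).symm
  rcases hl with hl | hl
  · obtain ⟨x, y, hx1, hxy, hlim⟩ := hl
    have happ : ∀ j t, 0 ≤ t →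
        Tendsto (fun m => T j t (x m) - Complex.exp (l j * t) • x m) atTop (𝓝 0) :=
      fun j t ht => JS.sg_approx_tendsto (hT j) (hM j) (hxy j) (l j) (hlim j) ht
    have hre : ∀ j, (l j).re ≤ 0 := by
      intro j
      refine JS.re_nonpos_of_bdd (C := M j) fun t ht => ?_
      have h1 : Tendsto (fun m => M j + ‖T j t (x m) - Complex.exp (l j * t) • x m‖) atTop
          (𝓝 (M j + ‖(0 : X)‖)) := (happ j t ht).norm.const_add _
      rw [norm_zero, add_zero] at h1
      refine ge_of_tendsto' h1 fun m => ?_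
      have h2 : ‖Complex.exp (l j * t) • x m‖ = Real.exp ((l j).re * t) := by
        rw [norm_smul, hx1, mul_one, Complex.norm_exp]; simp
      have h3 : ‖T j t (x m)‖ ≤ M j := by
        simpa [hx1 m] using (T j t).le_of_opNorm_le (hM j t ht) (x m)
      have h4 := norm_sub_norm_le (Complex.exp (l j * t) • x m) (T j t (x m))
      rw [norm_sub_rev] at h4
      linarith
    have hgapp : ∀ t, 0 ≤ t →
        Tendsto (fun m => g t (x m) - Complex.exp (α * t) • x m) atTop (𝓝 0) := by
      intro t ht
      haveI := (hν t ht).1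
      have hi1 := fun m => JS.Tprod_integrable hT hM (hνpos t ht) (x m)
      have hi2 := JS.exp_integrable (hνpos t ht) l hre
      have e : ∀ m, g t (x m) - Complex.exp (α * t) • x m
          = ∫ u, (Tprod T u (x m) - Complex.exp (∑ j, l j * (u j : ℂ)) • x m) ∂(ν t) := by
        intro m
        rw [integral_sub (hi1 m) (hi2.smul_const _), integral_smul_const,
          JS.subord hrep hν ht l hre, hg t ht, mul_comm]
      simp only [e]
      have := tendsto_integral_of_dominated_convergence (μ := ν t)
        (F := fun m u => Tprod T u (x m) - Complex.exp (∑ j, l j * (u j : ℂ)) • x m)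
        (f := fun _ => (0 : X)) (fun _ => C + 1)
        (fun m => ((hi1 m).sub (hi2.smul_const _)).aestronglyMeasurable)
        (integrable_const _) ?_ ?_
      · simpa using this
      · intro m
        filter_upwards [hνpos t ht] with u hu
        refine (norm_sub_le _ _).trans (add_le_add ?_ ?_)
        · simpa [hx1 m] using JS.Tprod_bound T M u (fun j => hM j _ (hu j)) (x m)
        · rw [norm_smul, hx1, mul_one, Complex.norm_exp, JS.re_sum]
          exact Real.exp_le_one_iff.2
            (Finset.sum_nonpos fun j _ => mul_nonpos_of_nonpos_of_nonneg (hre j) (hu j))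
      · filter_upwards [hνpos t ht] with u hu
        have := JS.Tprod_tendsto T u (fun j => Complex.exp (l j * (u j : ℂ))) x
          (fun j => happ j (u j) (hu j))
        rw [hprod] at this
        exact this
    have hgapp' : ∀ t : ℝ, 0 ≤ t →
        Tendsto (fun m => Complex.exp (-(α * t)) • g t (x m) - x m) atTop (𝓝 0) := by
      intro t ht
      simp only [JS.exp_neg_smul']
      simpa using (hgapp t ht).const_smul (Complex.exp (-(α * t)))
    have hgc := JS.sg_cont1 hgsem hgM
    set z : ℕ → X := fun m => ∫ s in (0 : ℝ)..1, Complex.exp (-(α * s)) • g (max s 0) (x m)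
      with hz
    have hkc : ∀ m, Continuous fun s : ℝ => Complex.exp (-(α * s)) • g (max s 0) (x m) := fun m =>
      (by fun_prop : Continuous fun s : ℝ => Complex.exp (-(α * s))).smul (hgc (x m))
    have hz1 : ∀ m, z m = -Rv (Complex.exp (-(α * (1 : ℝ))) • g 1 (x m) - x m) := by
      intro m
      have := hRv2 _ _ (JS.gen_integral hgsem hgc α zero_le_one (x m))
      rw [sub_add_cancel_right, map_neg] at this
      exact this.symm
    have hz0 : Tendsto z atTop (𝓝 0) := by
      have := ((Rv.continuous.tendsto 0).comp (hgapp' 1 zero_le_one)).neg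
      rw [map_zero, neg_zero] at this
      exact this.congr fun m => (hz1 m).symm
    have hzx : Tendsto (fun m => z m - x m) atTop (𝓝 0) := by
      have e : ∀ m, z m - x m
          = ∫ s in (0 : ℝ)..1, (Complex.exp (-(α * s)) • g (max s 0) (x m) - x m) := by
        intro m
        rw [intervalIntegral.integral_sub ((hkc m).intervalIntegrable _ _)
          intervalIntegrable_const]
        simp [hz]
      simp only [e]
      have := intervalIntegral.tendsto_integral_filter_of_dominated_convergence
        (μ := volume) (a := (0 : ℝ)) (b := 1) (l := atTop)
        (F := fun m (s : ℝ) => Complex.exp (-(α * s)) • g (max s 0) (x m) - x m)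
        (f := fun _ => (0 : X)) (fun _ => Real.exp ‖α‖ * C + 1)
        (Eventually.of_forall fun m => ((hkc m).sub continuous_const).aestronglyMeasurable)
        (Eventually.of_forall fun m => ?_) intervalIntegrable_const ?_
      · simpa using this
      · refine Eventually.of_forall fun s hs => ?_
        rw [Set.uIoc_of_le zero_le_one] at hs
        refine (norm_sub_le _ _).trans (add_le_add ?_ (hx1 m).le)
        rw [norm_smul]
        refine mul_le_mul ?_ ?_ (norm_nonneg _) (Real.exp_pos _).le
        · rw [Complex.norm_exp]
          apply Real.exp_le_exp.2
          refine (Complex.re_le_norm _).trans ?_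
          rw [norm_neg, norm_mul, Complex.norm_real, Real.norm_of_nonneg hs.1.le]
          exact mul_le_of_le_one_right (norm_nonneg _) hs.2
        · simpa [hx1 m] using (g (max s 0)).le_of_opNorm_le (hgM _ (le_max_right _ _)) (x m)
      · refine Eventually.of_forall fun s hs => ?_
        rw [Set.uIoc_of_le zero_le_one] at hs
        rw [max_eq_left hs.1.le]
        exact hgapp' s hs.1.le
    have hx0 := (hz0.sub hzx).norm
    simp only [sub_sub_cancel, hx1, sub_zero, norm_zero] at hx0
    exact one_ne_zero (tendsto_nhds_unique tendsto_const_nhds hx0)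
  · obtain ⟨f, hf0, hf⟩ := JS.exists_dual hl
    have hfj : ∀ j x y, InGenDomain (T j) x y → f (l j • x - y) = 0 := fun j x y hxy =>
      hf _ (Submodule.subset_span (Set.mem_iUnion.2 ⟨j, x, y, hxy, rfl⟩))
    have hfT : ∀ j t, 0 ≤ t → ∀ x, f (T j t x) = Complex.exp (l j * t) * f x :=
      fun j t ht x => JS.sg_residual (hT j) (hM j) (l j) f (hfj j) ht x
    obtain ⟨x₀, hx₀⟩ : ∃ x, f x ≠ 0 := by
      by_contra! h
      exact hf0 (ContinuousLinearMap.ext h)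
    have hre : ∀ j, (l j).re ≤ 0 := by
      intro j
      refine JS.re_nonpos_of_bdd (C := ‖f‖ * (M j * ‖x₀‖) / ‖f x₀‖) fun t ht => ?_
      rw [le_div_iff₀ (norm_pos_iff.2 hx₀)]
      have h2 : Real.exp ((l j).re * t) = ‖Complex.exp (l j * t)‖ := by
        rw [Complex.norm_exp]; simp
      rw [h2, ← norm_mul, ← hfT j t ht]
      refine (f.le_opNorm _).trans (mul_le_mul_of_nonneg_left ?_ (norm_nonneg _))
      exact (T j t).le_of_opNorm_le (hM j t ht) x₀
    have hfg : ∀ t, 0 ≤ t → ∀ x, f (g t x) = Complex.exp (α * t) * f x := by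
      intro t ht x
      haveI := (hν t ht).1
      rw [hg t ht, ← f.integral_comp_comm (JS.Tprod_integrable hT hM (hνpos t ht) x), mul_comm α,
        ← JS.subord hrep hν ht l hre, ← integral_mul_const]
      refine integral_congr_ae ?_
      filter_upwards [hνpos t ht] with u hu
      rw [JS.Tprod_dual T u (fun j => Complex.exp (l j * (u j : ℂ))) f
        (fun j x => hfT j (u j) (hu j) x) x, hprod]
    have hfB : ∀ x y, InGenDomain g x y → f y = α * f x := by
      intro x y hxy
      have h1 := (f.continuous.tendsto y).comp hxy
      have h0 : HasDerivAt (fun s : ℝ => (α * (s : ℂ))) α 0 := by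
        simpa using ((Complex.ofRealCLM.hasDerivAt (x := (0 : ℝ))).const_mul α)
      have h2 := (h0.cexp.mul_const (f x)).tendsto_slope_zero_right
      simp only [Complex.ofReal_zero, mul_zero, Complex.exp_zero, one_mul, zero_add] at h2
      refine tendsto_nhds_unique h1 (h2.congr' ?_)
      filter_upwards [self_mem_nhdsWithin] with t ht
      simp only [Function.comp]
      rw [f.map_smul_of_tower, map_sub, hfg t (le_of_lt ht)]
    have := hfB _ _ (hRv1 x₀)
    rw [map_sub, map_smul, smul_eq_mul, sub_eq_self] at this
    exact hx₀ this
end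

section
/- Let T₁,…,Tₙ be pairwise commuting C₀-semigroups on a complex Banach space X with ‖Tⱼ(t)‖ ≤ Mⱼ, and suppose Σⱼ₌₁ⁿ Cⱼ · limsup_{t→+0} ‖I − Tⱼ(t)‖ < 2, where C₁ = 1 and Cⱼ = M₁⋯M_{j−1} for j > 1. Then for every ψ ∈ T_n the operator ψ(A) is the generator of a uniformly holomorphic semigroup, i.e. the subordinated semigroup g(A) satisfies limsup_{t→+0} ‖I − g_t(A)‖ < 2. -/
open MeasureTheory Filter Topology

lemma aux_prod {X : Type*} [NormedAddCommGroup X] [NormedSpace ℂ X] :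
    ∀ {n : ℕ} (a : Fin n → X →L[ℂ] X) (M : Fin n → ℝ), (∀ j, ‖a j‖ ≤ M j) →
    ‖(1 : X →L[ℂ] X) - (List.ofFn a).prod‖ ≤
      ∑ j, (∏ k ∈ Finset.Iio j, M k) * ‖(1 : X →L[ℂ] X) - a j‖ := by
  intro n
  induction n with
  | zero => intro a M h; simp
  | succ n ih =>
    intro a M h
    have hp : ∀ j : Fin n, ∏ k ∈ Finset.Iio j.succ, M k =
        M 0 * ∏ k ∈ Finset.Iio j, M k.succ := by
      intro j
      have e1 : Finset.Iio j.succ = Finset.univ.filter (fun k => k < j.succ) := by ext; simp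
      have e2 : Finset.Iio j = Finset.univ.filter (fun k => k < j) := by ext; simp
      rw [e1, e2, Finset.prod_filter, Finset.prod_filter, Fin.prod_univ_succ]
      simp
    have h0 : ∏ k ∈ Finset.Iio (0 : Fin (n+1)), M k = 1 := by
      have e1 : Finset.Iio (0 : Fin (n+1)) = ∅ := by ext; simp
      rw [e1]; simp
    rw [List.ofFn_succ, List.prod_cons, Fin.sum_univ_succ, h0, one_mul]
    simp_rw [hp, mul_assoc]
    rw [← Finset.mul_sum]
    have key := ih (fun i => a i.succ) (fun i => M i.succ) (fun i => h i.succ)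
    set P := (List.ofFn (fun i => a i.succ)).prod
    have e : (1 : X →L[ℂ] X) - a 0 * P = (1 - a 0) + a 0 * (1 - P) := by
      rw [mul_sub, mul_one]; abel
    rw [e]
    refine (norm_add_le _ _).trans (add_le_add le_rfl ((norm_mul_le _ _).trans ?_))
    exact mul_le_mul (h 0) key (norm_nonneg _) ((norm_nonneg _).trans (h 0))

lemma aux_mass {n : ℕ} (ν : Measure (Fin n → ℝ)) [IsFiniteMeasure ν]
    (h0 : ν {u | ¬ ∀ j, 0 ≤ u j} = 0)
    (h1 : ∀ s ∈ negOrthant n, ∫ u, Real.exp (∑ j, s j * u j) ∂ν ≤ 1) :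
    ν.real Set.univ ≤ 1 := by
  have hae : ∀ᵐ u ∂ν, ∀ j, 0 ≤ u j := h0
  have ht : Tendsto (fun k : ℕ => ∫ u, Real.exp (∑ j, (-(1 / ((k:ℝ) + 1))) * u j) ∂ν) atTop
      (𝓝 (∫ _u, (1:ℝ) ∂ν)) := by
    refine tendsto_integral_of_dominated_convergence (fun _ => (1:ℝ)) ?_ (integrable_const _) ?_ ?_
    · intro k
      exact Continuous.aestronglyMeasurable (by fun_prop)
    · intro k
      filter_upwards [hae] with u hu
      rw [Real.norm_eq_abs, Real.abs_exp]
      apply Real.exp_le_one_iff.2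
      apply Finset.sum_nonpos
      intro j _
      have : (0:ℝ) ≤ 1 / ((k:ℝ) + 1) := by positivity
      nlinarith [mul_nonneg this (hu j)]
    · filter_upwards with u
      have h2 : Tendsto (fun k : ℕ => ∑ j, (-(1 / ((k:ℝ) + 1))) * u j) atTop
          (𝓝 (∑ j, (-0) * u j)) :=
        tendsto_finsetSum _ fun j _ => (tendsto_one_div_add_atTop_nhds_zero_nat.neg).mul_const _
      have := (Real.continuous_exp.tendsto _).comp h2
      simpa [Function.comp_def] using this
  have := le_of_tendsto' ht (b := 1) (fun k => h1 (fun _ => -(1 / ((k:ℝ) + 1)))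
    (fun j => by have : (0:ℝ) < 1 / ((k:ℝ) + 1) := by positivity
                 linarith))
  simpa using this

lemma aux_big {n : ℕ} (ν : Measure (Fin n → ℝ)) [IsFiniteMeasure ν]
    (h0 : ν {u | ¬ ∀ j, 0 ≤ u j} = 0) (hm : ν.real Set.univ ≤ 1) (δ e : ℝ)
    (he : ∫ u, Real.exp (∑ j, (-1 : ℝ) * u j) ∂ν = e) :
    e ≤ ν.real Set.univ ∧
      (1 - Real.exp (-δ)) * ν.real {u | ∃ j, δ ≤ u j} ≤ 1 - e := by
  have hae : ∀ᵐ u ∂ν, ∀ j, 0 ≤ u j := h0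
  have hmeas : MeasurableSet {u : Fin n → ℝ | ∃ j, δ ≤ u j} := by
    have : {u : Fin n → ℝ | ∃ j, δ ≤ u j} = ⋃ j, {u | δ ≤ u j} := by ext; simp
    rw [this]
    exact MeasurableSet.iUnion fun j => measurableSet_le measurable_const (measurable_pi_apply j)
  have hle1 : ∀ᵐ u ∂ν, Real.exp (∑ j, (-1 : ℝ) * u j) ≤ 1 := by
    filter_upwards [hae] with u hu
    apply Real.exp_le_one_iff.2
    apply Finset.sum_nonpos
    intro j _
    linarith [hu j]
  have hint : Integrable (fun u : Fin n → ℝ => Real.exp (∑ j, (-1 : ℝ) * u j)) ν := by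
    refine Integrable.of_bound (C := 1) (Continuous.aestronglyMeasurable (by fun_prop)) ?_
    filter_upwards [hle1] with u hu
    rwa [Real.norm_eq_abs, Real.abs_exp]
  constructor
  · rw [← he]
    have := integral_mono_ae hint (integrable_const (1:ℝ)) hle1
    simpa using this
  · set B := {u : Fin n → ℝ | ∃ j, δ ≤ u j}
    have hi2 : Integrable (B.indicator fun _ => (1 - Real.exp (-δ))) ν :=
      (integrable_const _).indicator hmeas
    have key : ∫ u, (Real.exp (∑ j, (-1 : ℝ) * u j) + B.indicator (fun _ => (1 - Real.exp (-δ))) u) ∂ν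
        ≤ ∫ _u, (1:ℝ) ∂ν := by
      refine integral_mono_ae (hint.add hi2) (integrable_const _) ?_
      filter_upwards [hae, hle1] with u hu hu1
      by_cases hb : u ∈ B
      · obtain ⟨j, hj⟩ := id hb
        have h3 : ∑ j, (-1 : ℝ) * u j ≤ -δ := by
          rw [← Finset.mul_sum]
          have := Finset.single_le_sum (f := u) (fun i _ => hu i) (Finset.mem_univ j)
          linarith
        have := Real.exp_le_exp.2 h3
        simp only [Set.indicator_of_mem hb]
        linarith
      · simp only [Set.indicator_of_notMem hb]
        linarith
    rw [integral_add hint hi2, he, integral_indicator_const _ hmeas] at key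
    simp at key
    linarith

/-- If the pairwise commuting semigroups `Tⱼ` satisfy `‖Tⱼ(t)‖ ≤ Mⱼ` and
`Σⱼ Cⱼ · limsup_{t→+0} ‖I - Tⱼ(t)‖ < 2` with `C₁ = 1`, `Cⱼ = M₁⋯M_{j-1}`, then for every
`ψ ∈ 𝒯ₙ` the operator `ψ(A)` generates a uniformly holomorphic semigroup, i.e. the
subordinated semigroup `g(A)` satisfies `limsup_{t→+0} ‖I - g_t(A)‖ < 2`. -/
theorem subordinated_uniformly_holomorphic
    {X : Type*} [NormedAddCommGroup X] [NormedSpace ℂ X] [CompleteSpace X]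
    {n : ℕ} (T : Fin n → ℝ → X →L[ℂ] X) (M : Fin n → ℝ)
    (hT : ∀ j, IsC0Semigroup (T j)) (hM : ∀ j t, 0 ≤ t → ‖T j t‖ ≤ M j)
    (hcomm : ∀ i j s t, 0 ≤ s → 0 ≤ t → T i s ∘L T j t = T j t ∘L T i s)
    (ψ : (Fin n → ℝ) → ℝ) (c₀ : ℝ) (c₁ : Fin n → ℝ) (μ : MeasureTheory.Measure (Fin n → ℝ))
    (hψ : MemTn n ψ) (hrep : HasLevyRep n ψ c₀ c₁ μ)
    (ν : ℝ → MeasureTheory.Measure (Fin n → ℝ)) (hν : IsSubordinator n ψ ν)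
    (g : ℝ → X →L[ℂ] X) (hgsem : IsC0Semigroup g)
    (hg : ∀ t, 0 ≤ t → ∀ x : X, g t x = ∫ u, Tprod T u x ∂(ν t))
    (hsum : ∑ j, (∏ k ∈ Finset.Iio j, M k) *
        Filter.limsup (fun t => ‖(1 : X →L[ℂ] X) - T j t‖) (𝓝[>] (0 : ℝ)) < 2) :
    Filter.limsup (fun t => ‖(1 : X →L[ℂ] X) - g t‖) (𝓝[>] (0 : ℝ)) < 2 := by
  have hM0 : ∀ j, 0 ≤ M j := fun j => (norm_nonneg _).trans (hM j 0 le_rfl)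
  have hC0 : ∀ j, 0 ≤ ∏ k ∈ Finset.Iio j, M k := fun j => Finset.prod_nonneg fun k _ => hM0 k
  set C : Fin n → ℝ := fun j => ∏ k ∈ Finset.Iio j, M k with hC
  set L : Fin n → ℝ := fun j => limsup (fun t => ‖(1 : X →L[ℂ] X) - T j t‖) (𝓝[>] (0 : ℝ)) with hL
  have hle : ∀ j t, 0 ≤ t → ‖(1 : X →L[ℂ] X) - T j t‖ ≤ 1 + M j := fun j t ht =>
    (norm_sub_le _ _).trans (add_le_add ContinuousLinearMap.norm_id_le (hM j t ht))
  have hbdd : ∀ j, IsBoundedUnder (· ≤ ·) (𝓝[>] (0 : ℝ)) (fun t => ‖(1 : X →L[ℂ] X) - T j t‖) := by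
    intro j
    refine ⟨1 + M j, ?_⟩
    rw [eventually_map]
    filter_upwards [self_mem_nhdsWithin] with t ht using hle j t (le_of_lt ht)
  have hL0 : ∀ j, 0 ≤ L j := fun j =>
    le_limsup_of_frequently_le (Eventually.frequently (Eventually.of_forall fun t => norm_nonneg _))
      (hbdd j)
  -- choose eta
  obtain ⟨η, hη0, hη⟩ : ∃ η : ℝ, 0 < η ∧ ∑ j, C j * (L j + η) < 2 := by
    have hc : Continuous (fun η : ℝ => ∑ j, C j * (L j + η)) := by fun_prop
    have h2 : ∀ᶠ η in 𝓝 (0:ℝ), ∑ j, C j * (L j + η) < 2 :=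
      hc.continuousAt.eventually_lt_const (by simpa using hsum)
    obtain ⟨η, h3, h4⟩ := ((h2.filter_mono nhdsWithin_le_nhds).and
      (self_mem_nhdsWithin : Set.Ioi (0:ℝ) ∈ 𝓝[>] 0)).exists
    exact ⟨η, h4, h3⟩
  obtain ⟨δ, hδ0, hδ⟩ : ∃ δ : ℝ, 0 < δ ∧ ∀ t, 0 < t → t < δ → ∀ j,
      ‖(1 : X →L[ℂ] X) - T j t‖ < L j + η := by
    have : ∀ᶠ t in 𝓝[>] (0:ℝ), ∀ j, ‖(1 : X →L[ℂ] X) - T j t‖ < L j + η :=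
      eventually_all.2 fun j => eventually_lt_of_limsup_lt (by simp only [hL]; linarith) (hbdd j)
    obtain ⟨δ, h1, h2⟩ := mem_nhdsGT_iff_exists_Ioo_subset.1 this
    exact ⟨δ, h1, fun t ht ht' => h2 ⟨ht, ht'⟩⟩
  set q : ℝ := max 1 (∑ j, C j * (L j + η)) with hq
  have hq2 : q < 2 := max_lt (by norm_num) hη
  have hq1 : 1 ≤ q := le_max_left _ _
  set K : ℝ := ∑ j, C j * (1 + M j) with hK
  have hK0 : 0 ≤ K := Finset.sum_nonneg fun j _ => mul_nonneg (hC0 j) (by linarith [hM0 j])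
  set B := {u : Fin n → ℝ | ∃ j, δ ≤ u j} with hB
  have hmeas : MeasurableSet B := by
    have : B = ⋃ j, {u | δ ≤ u j} := by ext; simp [hB]
    rw [this]
    exact MeasurableSet.iUnion fun j => measurableSet_le measurable_const (measurable_pi_apply j)
  have hP : ∀ u : Fin n → ℝ, (∀ j, 0 ≤ u j) →
      ‖(1 : X →L[ℂ] X) - Tprod T u‖ ≤ q + B.indicator (fun _ => K) u := by
    intro u hu
    have h1 := aux_prod (fun j => T j (u j)) M (fun j => hM j _ (hu j))
    refine h1.trans ?_
    by_cases hb : u ∈ B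
    · rw [Set.indicator_of_mem hb]
      have : ∑ j, C j * ‖(1 : X →L[ℂ] X) - T j (u j)‖ ≤ K :=
        Finset.sum_le_sum fun j _ => mul_le_mul_of_nonneg_left (hle j _ (hu j)) (hC0 j)
      linarith
    · rw [Set.indicator_of_notMem hb, add_zero]
      refine le_trans (Finset.sum_le_sum fun j _ => mul_le_mul_of_nonneg_left ?_ (hC0 j))
        (le_max_right _ _)
      have hb' : u j < δ := by
        by_contra h
        exact hb ⟨j, not_lt.1 h⟩
      rcases (hu j).eq_or_lt with h | h
      · rw [← h, (hT j).1]
        simp only [sub_self, norm_zero]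
        linarith [hL0 j]
      · exact (hδ _ h hb' j).le
  set p : ℝ := ψ (fun _ => -1) with hp
  have hs1 : (fun _ => -1 : Fin n → ℝ) ∈ negOrthant n := fun j => by norm_num
  have hd : 0 < 1 - Real.exp (-δ) := by
    have : Real.exp (-δ) < 1 := Real.exp_lt_one_iff.2 (by linarith)
    linarith
  have main : ∀ t, 0 ≤ t → ‖(1 : X →L[ℂ] X) - g t‖ ≤
      q + (1 - Real.exp (t * p)) * (1 + K / (1 - Real.exp (-δ))) := by
    intro t ht
    obtain ⟨hfin, hsupp, hlap⟩ := hν t ht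
    have hm : (ν t).real Set.univ ≤ 1 := aux_mass (ν t) hsupp fun s hs => by
      rw [hlap s hs]
      exact Real.exp_le_one_iff.2 (mul_nonpos_of_nonneg_of_nonpos ht (hψ.2.1 s hs))
    obtain ⟨hm1, hbig⟩ := aux_big (ν t) hsupp hm δ (Real.exp (t * p)) (hlap _ hs1)
    have hbig' : (ν t).real B ≤ (1 - Real.exp (t * p)) / (1 - Real.exp (-δ)) := by
      rw [le_div_iff₀ hd]; linarith
    have he1 : 0 ≤ 1 - Real.exp (t * p) := by linarith
    have hR : 0 ≤ (1 - Real.exp (t * p)) * (1 + K / (1 - Real.exp (-δ))) :=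
      mul_nonneg he1 (by have := div_nonneg hK0 hd.le; linarith)
    refine ContinuousLinearMap.opNorm_le_bound _ (by linarith) fun x => ?_
    have hx : ((1 : X →L[ℂ] X) - g t) x = x - g t x := by simp
    rw [hx, hg t ht x]
    by_cases hi : Integrable (fun u => Tprod T u x) (ν t)
    · set m := (ν t).real Set.univ with hmdef
      have e1 : x - ∫ u, Tprod T u x ∂(ν t) =
          (1 - m) • x + ∫ u, (x - Tprod T u x) ∂(ν t) := by
        rw [integral_sub (integrable_const x) hi, integral_const, sub_smul, one_smul]
        abel
      have hgi : Integrable (fun u => (q + B.indicator (fun _ => K) u) * ‖x‖) (ν t) :=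
        ((integrable_const _).add ((integrable_const _).indicator hmeas)).mul_const _
      have e2 : ‖∫ u, (x - Tprod T u x) ∂(ν t)‖ ≤
          ∫ u, (q + B.indicator (fun _ => K) u) * ‖x‖ ∂(ν t) := by
        refine norm_integral_le_of_norm_le hgi ?_
        have hae : ∀ᵐ u ∂(ν t), ∀ j, 0 ≤ u j := hsupp
        filter_upwards [hae] with u hu
        have := ((1 : X →L[ℂ] X) - Tprod T u).le_of_opNorm_le (hP u hu) x
        simpa using this
      have e3 : ∫ u, (q + B.indicator (fun _ => K) u) * ‖x‖ ∂(ν t) =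
          (q * m + (ν t).real B * K) * ‖x‖ := by
        rw [integral_mul_const, integral_add (integrable_const _)
          ((integrable_const _).indicator hmeas), integral_indicator_const _ hmeas, integral_const]
        simp only [smul_eq_mul]
        rw [mul_comm q]
      rw [e1]
      have e4 : ‖(1 - m) • x‖ = (1 - m) * ‖x‖ := by
        rw [norm_smul, Real.norm_eq_abs, abs_of_nonneg (by linarith)]
      refine (norm_add_le _ _).trans ?_
      rw [e4]
      refine (add_le_add le_rfl (e2.trans e3.le)).trans ?_
      rw [← add_mul]
      refine mul_le_mul_of_nonneg_right ?_ (norm_nonneg _)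
      have h5 : q * m ≤ q := by nlinarith
      have h6 := mul_le_mul_of_nonneg_right hbig' hK0
      have h7 : (1 - Real.exp (t * p)) / (1 - Real.exp (-δ)) * K =
        (1 - Real.exp (t * p)) * (K / (1 - Real.exp (-δ))) := by ring
      rw [h7] at h6
      linarith
    · rw [integral_undef hi, sub_zero]
      have := norm_nonneg x
      nlinarith
  obtain ⟨q', hq', hq'2⟩ := exists_between hq2
  refine lt_of_le_of_lt ?_ hq'2
  refine limsup_le_of_le ?_ ?_
  · exact IsBoundedUnder.isCoboundedUnder_le ⟨0, by
      rw [eventually_map]; exact Eventually.of_forall fun t => norm_nonneg _⟩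
  · have hc : Continuous (fun t : ℝ => q + (1 - Real.exp (t * p)) * (1 + K / (1 - Real.exp (-δ)))) := by
      fun_prop
    have h2 : ∀ᶠ t in 𝓝 (0:ℝ), q + (1 - Real.exp (t * p)) * (1 + K / (1 - Real.exp (-δ))) < q' :=
      hc.continuousAt.eventually_lt_const (by simpa using hq')
    filter_upwards [h2.filter_mono nhdsWithin_le_nhds, self_mem_nhdsWithin] with t h3 h4
    exact (main t (le_of_lt h4)).trans h3.le
end
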